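/- In the coordinate hypersurface-variation setup, with k_t := Σ_{a,b} (h_t)^{ab} (K_t)_{ab}, Tr_h(K²) := Σ_{a,b,c,d} h^{ab} K_{bc} h^{cd} K_{da}, Ric_{αβ} := Σ_λ R^λ_{αλβ} where R^λ_{αμβ} := ∂_μ Γ^λ_{αβ} − ∂_β Γ^λ_{αμ} + Σ_σ ( Γ^λ_{σμ} Γ^σ_{αβ} − Γ^λ_{σβ} Γ^σ_{αμ} ), the following first-variation identity for the mean-curvature density holds at every point of U: ∂_t ( k_t √|det h_t| ) |_{t=0} = f ( k² − Tr_h(K²) − Σ_{α,β} Ric_{αβ}(φ₀) n₀^α n₀^β ) √|det h| + Σ_a ∂_a ( √|det h| ( k X^a − ϵ Σ_b h^{ab} ∂_b f ) ). -/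

import Mathlib

noncomputable section

/-- The partial derivative `∂_a f` of a function on `ℝ^N` in the `a`-th coordinate
direction. -/
def pder {N : ℕ} (f : (Fin N → ℝ) → ℝ) (a : Fin N) (x : Fin N → ℝ) : ℝ :=
  fderiv ℝ f x (Pi.single a 1)

/-- The pointwise inverse components `g^{μν}` of a metric given in components. -/
def ginv {N : ℕ} (g : (Fin N → ℝ) → Fin N → Fin N → ℝ) (x : Fin N → ℝ)
    (μ ν : Fin N) : ℝ :=
  (Matrix.of (g x))⁻¹ μ ν

/-- The Christoffel symbols
`Γ^l_{μν} = (1/2) Σ_σ g^{lσ} (∂_μ g_{σν} + ∂_ν g_{σμ} − ∂_σ g_{μν})` of the metric `g`. -/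
def christoffel {N : ℕ} (g : (Fin N → ℝ) → Fin N → Fin N → ℝ) (x : Fin N → ℝ)
    (l μ ν : Fin N) : ℝ :=
  (1 / 2) * ∑ σ, ginv g x l σ *
    (pder (fun z => g z σ ν) μ x + pder (fun z => g z σ μ) ν x
      - pder (fun z => g z μ ν) σ x)

/-- The spatial derivative `∂_a φ_t^μ` of the hypersurface family. -/
def Dphi {n : ℕ} (φ : ℝ → (Fin n → ℝ) → Fin (n + 1) → ℝ) (t : ℝ) (y : Fin n → ℝ)
    (a : Fin n) (μ : Fin (n + 1)) : ℝ :=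
  pder (fun z => φ t z μ) a y

/-- The induced metric `(h_t)_{ab} = Σ_{μν} g_{μν}(φ_t) ∂_aφ_t^μ ∂_bφ_t^ν`. -/
def indMet {n : ℕ} (g : (Fin (n + 1) → ℝ) → Fin (n + 1) → Fin (n + 1) → ℝ)
    (φ : ℝ → (Fin n → ℝ) → Fin (n + 1) → ℝ) (t : ℝ) (y : Fin n → ℝ)
    (a b : Fin n) : ℝ :=
  ∑ μ, ∑ ν, g (φ t y) μ ν * Dphi φ t y a μ * Dphi φ t y b ν

/-- The inverse `(h_t)^{ab}` of the induced metric. -/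
def indMetInv {n : ℕ} (g : (Fin (n + 1) → ℝ) → Fin (n + 1) → Fin (n + 1) → ℝ)
    (φ : ℝ → (Fin n → ℝ) → Fin (n + 1) → ℝ) (t : ℝ) (y : Fin n → ℝ)
    (a b : Fin n) : ℝ :=
  (Matrix.of (fun a b => indMet g φ t y a b))⁻¹ a b

/-- The extrinsic curvature
`(K_t)_{ab} = Σ_{μν} g_{μν}(φ_t) ∂_aφ_t^μ (∂_b n_t^ν + Σ_{lσ} Γ^ν_{lσ}(φ_t) ∂_bφ_t^l n_t^σ)`. -/
def extK {n : ℕ} (g : (Fin (n + 1) → ℝ) → Fin (n + 1) → Fin (n + 1) → ℝ)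
    (φ nrm : ℝ → (Fin n → ℝ) → Fin (n + 1) → ℝ) (t : ℝ) (y : Fin n → ℝ)
    (a b : Fin n) : ℝ :=
  ∑ μ, ∑ ν, g (φ t y) μ ν * Dphi φ t y a μ *
    (pder (fun z => nrm t z ν) b y
      + ∑ l, ∑ σ, christoffel g (φ t y) ν l σ * Dphi φ t y b l * nrm t y σ)

/-- The trace `k_t = (h_t)^{ab} (K_t)_{ab}` of the extrinsic curvature. -/
def trExtK {n : ℕ} (g : (Fin (n + 1) → ℝ) → Fin (n + 1) → Fin (n + 1) → ℝ)
    (φ nrm : ℝ → (Fin n → ℝ) → Fin (n + 1) → ℝ) (t : ℝ) (y : Fin n → ℝ) : ℝ :=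
  ∑ a, ∑ b, indMetInv g φ t y a b * extK g φ nrm t y a b

/-- The Riemann curvature components
`R^l_{αμβ} = ∂_μ Γ^l_{αβ} − ∂_β Γ^l_{αμ} + Σ_σ (Γ^l_{σμ} Γ^σ_{αβ} − Γ^l_{σβ} Γ^σ_{αμ})`. -/
def riemann {N : ℕ} (g : (Fin N → ℝ) → Fin N → Fin N → ℝ) (x : Fin N → ℝ)
    (l α μ β : Fin N) : ℝ :=
  pder (fun z => christoffel g z l α β) μ x
    - pder (fun z => christoffel g z l α μ) β x
    + ∑ σ, (christoffel g x l σ μ * christoffel g x σ α β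
        - christoffel g x l σ β * christoffel g x σ α μ)

/-- The lowered Riemann tensor `R_{μανβ} = Σ_l g_{μl} R^l_{ανβ}`. -/
def riemannLow {N : ℕ} (g : (Fin N → ℝ) → Fin N → Fin N → ℝ) (x : Fin N → ℝ)
    (μ α ν β : Fin N) : ℝ :=
  ∑ l, g x μ l * riemann g x l α ν β

/-- The Ricci tensor `Ric_{αβ} = Σ_l R^l_{αlβ}`. -/
def ricci {N : ℕ} (g : (Fin N → ℝ) → Fin N → Fin N → ℝ) (x : Fin N → ℝ)
    (α β : Fin N) : ℝ :=
  ∑ l, riemann g x l α l β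

/-- The Christoffel symbols `Γ^{Σ,c}_{ab}` of the induced metric `h₀`. -/
def christoffelInd {n : ℕ} (g : (Fin (n + 1) → ℝ) → Fin (n + 1) → Fin (n + 1) → ℝ)
    (φ : ℝ → (Fin n → ℝ) → Fin (n + 1) → ℝ) (y : Fin n → ℝ) (c a b : Fin n) : ℝ :=
  (1 / 2) * ∑ d, indMetInv g φ 0 y c d *
    (pder (fun z => indMet g φ 0 z d b) a y + pder (fun z => indMet g φ 0 z d a) b y
      - pder (fun z => indMet g φ 0 z a b) d y)

open scoped ContDiff Matrix

section DirectionalDerivative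

variable {E : Type*} [NormedAddCommGroup E] [NormedSpace ℝ E]

/-- The derivative of a scalar function in the direction of a fixed vector. -/
def dirDeriv (v : E) (F : E → ℝ) (q : E) : ℝ := fderiv ℝ F q v

variable {v w : E} {F G : E → ℝ} {q : E} {S : Set E}

lemma dirDeriv_const (c : ℝ) : dirDeriv v (fun _ => c) q = 0 := by
  simp [dirDeriv]

lemma dirDeriv_add (hF : DifferentiableAt ℝ F q) (hG : DifferentiableAt ℝ G q) :
    dirDeriv v (fun p => F p + G p) q = dirDeriv v F q + dirDeriv v G q := by
  simp [dirDeriv, fderiv_fun_add hF hG]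

lemma dirDeriv_sub (hF : DifferentiableAt ℝ F q) (hG : DifferentiableAt ℝ G q) :
    dirDeriv v (fun p => F p - G p) q = dirDeriv v F q - dirDeriv v G q := by
  simp [dirDeriv, fderiv_fun_sub hF hG]

lemma dirDeriv_mul (hF : DifferentiableAt ℝ F q) (hG : DifferentiableAt ℝ G q) :
    dirDeriv v (fun p => F p * G p) q = dirDeriv v F q * G q + F q * dirDeriv v G q := by
  simp [dirDeriv, fderiv_fun_mul hF hG]; ring

lemma dirDeriv_const_mul (c : ℝ) (hF : DifferentiableAt ℝ F q) :
    dirDeriv v (fun p => c * F p) q = c * dirDeriv v F q := by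
  rw [dirDeriv_mul (by fun_prop) hF, dirDeriv_const]; ring

lemma dirDeriv_sum {ι : Type*} {s : Finset ι} {A : ι → E → ℝ}
    (hA : ∀ i ∈ s, DifferentiableAt ℝ (A i) q) :
    dirDeriv v (fun p => ∑ i ∈ s, A i p) q = ∑ i ∈ s, dirDeriv v (A i) q := by
  simp [dirDeriv, fderiv_fun_sum hA]

lemma dirDeriv_congr (hS : IsOpen S) (hq : q ∈ S) (h : ∀ p ∈ S, F p = G p) :
    dirDeriv v F q = dirDeriv v G q := by
  have : F =ᶠ[nhds q] G := Filter.eventuallyEq_of_mem (hS.mem_nhds hq) h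
  simp [dirDeriv, this.fderiv_eq]

lemma dirDeriv_add_dir : dirDeriv (v + w) F q = dirDeriv v F q + dirDeriv w F q := by
  simp [dirDeriv]

lemma dirDeriv_smul_dir (c : ℝ) : dirDeriv (c • v) F q = c * dirDeriv v F q := by
  simp [dirDeriv]

lemma dirDeriv_sum_dir {ι : Type*} {s : Finset ι} {A : ι → E} :
    dirDeriv (∑ i ∈ s, A i) F q = ∑ i ∈ s, dirDeriv (A i) F q := by
  simp [dirDeriv]

lemma ContDiffOn.differentiableAt_of_isOpen (hF : ContDiffOn ℝ ∞ F S) (hS : IsOpen S)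
    (hq : q ∈ S) : DifferentiableAt ℝ F q :=
  (hF.contDiffAt (hS.mem_nhds hq)).differentiableAt (by simp)

lemma ContDiffOn.dirDeriv (hF : ContDiffOn ℝ ∞ F S) (hS : IsOpen S) (v : E) :
    ContDiffOn ℝ ∞ (dirDeriv v F) S :=
  (hF.fderiv_of_isOpen hS (m := ∞) (by simp)).clm_apply contDiffOn_const

lemma dirDeriv_comm (hF : ContDiffOn ℝ ∞ F S) (hS : IsOpen S) (hq : q ∈ S) :
    dirDeriv v (dirDeriv w F) q = dirDeriv w (dirDeriv v F) q := by
  have hF' := hF.contDiffAt (hS.mem_nhds hq)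
  have hd : DifferentiableAt ℝ (fderiv ℝ F) q :=
    ((hF'.fderiv_right (m := 1) (by norm_cast)).differentiableAt (by simp))
  have key : ∀ a b : E, dirDeriv a (dirDeriv b F) q = fderiv ℝ (fderiv ℝ F) q a b := by
    intro a b
    change fderiv ℝ (fun p => fderiv ℝ F p b) q a = _
    rw [fderiv_clm_apply hd (by fun_prop)]
    simp
  rw [key, key]
  exact (hF'.isSymmSndFDerivAt
    (by
      rw [minSmoothness_of_isRCLikeNormedField]
      exact WithTop.coe_le_coe.2 (le_top : (2 : ℕ∞) ≤ ⊤))).eq v w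

lemma dirDeriv_comp_coord {N : ℕ} {A : (Fin N → ℝ) → ℝ} {Φ : E → Fin N → ℝ}
    (hA : DifferentiableAt ℝ A (Φ q)) (hΦ : ∀ i, DifferentiableAt ℝ (fun p => Φ p i) q) :
    dirDeriv v (fun p => A (Φ p)) q
      = ∑ s, pder A s (Φ q) * dirDeriv v (fun p => Φ p s) q := by
  have hΦ' : DifferentiableAt ℝ Φ q := differentiableAt_pi.2 hΦ
  have h1 : fderiv ℝ (fun p => A (Φ p)) q = (fderiv ℝ A (Φ q)).comp (fderiv ℝ Φ q) :=
    fderiv_comp q hA hΦ'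
  have h2 : fderiv ℝ Φ q v = ∑ s, dirDeriv v (fun p => Φ p s) q • Pi.single s (1 : ℝ) := by
    ext i
    simp [dirDeriv, Finset.sum_apply, Pi.single_apply, fderiv_apply hΦ']
  rw [dirDeriv, h1, ContinuousLinearMap.comp_apply, h2]
  simp [pder, mul_comm]

lemma dirDeriv_comp {A : ℝ → ℝ} {A' : ℝ} (hA : HasDerivAt A A' (F q))
    (hF : DifferentiableAt ℝ F q) :
    dirDeriv v (fun p => A (F p)) q = A' * dirDeriv v F q := by
  have := hA.comp_hasFDerivAt q hF.hasFDerivAt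
  have h : fderiv ℝ (fun p => A (F p)) q = A' • fderiv ℝ F q := this.fderiv
  simp [dirDeriv, h]

end DirectionalDerivative

section MatrixCalculus

variable {E : Type*} [NormedAddCommGroup E] [NormedSpace ℝ E]
variable {ι : Type*} [Fintype ι] {H : E → Matrix ι ι ℝ} {S : Set E} {q v : E}

/-- Entrywise directional derivative of a matrix-valued function. -/
def matDeriv (v : E) (H : E → Matrix ι ι ℝ) (q : E) : Matrix ι ι ℝ :=
  Matrix.of fun i j => dirDeriv v (fun p => H p i j) q

lemma matDeriv_mul {A B : E → Matrix ι ι ℝ}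
    (hA : ∀ i j, DifferentiableAt ℝ (fun p => A p i j) q)
    (hB : ∀ i j, DifferentiableAt ℝ (fun p => B p i j) q) :
    matDeriv v (fun p => A p * B p) q = matDeriv v A q * B q + A q * matDeriv v B q := by
  ext i j
  simp only [matDeriv, Matrix.of_apply, Matrix.mul_apply, Matrix.add_apply]
  rw [dirDeriv_sum (fun k _ => by fun_prop), ← Finset.sum_add_distrib]
  exact Finset.sum_congr rfl fun k _ => dirDeriv_mul (hA _ _) (hB _ _)

lemma dirDeriv_trace {A : E → Matrix ι ι ℝ}
    (hA : ∀ i j, DifferentiableAt ℝ (fun p => A p i j) q) :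
    dirDeriv v (fun p => (A p).trace) q = (matDeriv v A q).trace := by
  simp only [Matrix.trace, Matrix.diag]
  rw [dirDeriv_sum (fun k _ => hA k k)]
  rfl

variable [DecidableEq ι]

lemma ContDiffOn.matrix_det (hH : ∀ i j, ContDiffOn ℝ ∞ (fun p => H p i j) S) :
    ContDiffOn ℝ ∞ (fun p => (H p).det) S := by
  simp only [Matrix.det_apply']
  exact ContDiffOn.sum fun σ _ => contDiffOn_const.mul (contDiffOn_prod fun i _ => hH _ _)

lemma ContDiffOn.matrix_inv (hH : ∀ i j, ContDiffOn ℝ ∞ (fun p => H p i j) S)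
    (hdet : ∀ p ∈ S, (H p).det ≠ 0) (i j : ι) :
    ContDiffOn ℝ ∞ (fun p => (H p)⁻¹ i j) S := by
  have h : ∀ p, (H p)⁻¹ i j = ((H p).det)⁻¹ * ((H p).updateRow j (Pi.single i 1)).det := by
    intro p
    rw [Matrix.inv_def, Matrix.smul_apply, Matrix.adjugate_apply, Ring.inverse_eq_inv', smul_eq_mul]
  simp only [h]
  refine (ContDiffOn.inv (ContDiffOn.matrix_det hH) hdet).mul (ContDiffOn.matrix_det ?_)
  intro a b
  by_cases hab : a = j
  · subst hab; simp only [Matrix.updateRow_self]; exact contDiffOn_const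
  · simpa only [Matrix.updateRow_ne hab] using hH a b

lemma dirDeriv_prod {κ : Type*} [DecidableEq κ] {s : Finset κ} {A : κ → E → ℝ}
    (hA : ∀ i ∈ s, DifferentiableAt ℝ (A i) q) :
    dirDeriv v (fun p => ∏ i ∈ s, A i p) q
      = ∑ i ∈ s, (∏ j ∈ s.erase i, A j q) * dirDeriv v (A i) q := by
  have := HasFDerivAt.finsetProd (u := s) (g := A) (fun i hi => (hA i hi).hasFDerivAt)
  simp [dirDeriv, this.fderiv]

lemma dirDeriv_det (hH : ∀ i j, DifferentiableAt ℝ (fun p => H p i j) q) :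
    dirDeriv v (fun p => (H p).det) q = ((H q).adjugate * matDeriv v H q).trace := by
  have h1 : dirDeriv v (fun p => (H p).det) q
      = ∑ i, ((H q).updateCol i (fun a => matDeriv v H q a i)).det := by
    simp only [Matrix.det_apply']
    rw [dirDeriv_sum (fun σ _ => by fun_prop), Finset.sum_comm]
    refine Finset.sum_congr rfl fun σ _ => ?_
    rw [dirDeriv_const_mul _ (by fun_prop), dirDeriv_prod (fun i _ => hH _ _), Finset.mul_sum]
    refine Finset.sum_congr rfl fun i _ => ?_
    rw [← Finset.mul_prod_erase Finset.univ _ (Finset.mem_univ i), Matrix.updateCol_self,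
      mul_comm (∏ j ∈ _, _)]
    congr 2
    refine Finset.prod_congr rfl fun j hj => ?_
    rw [Matrix.updateCol_ne (Finset.ne_of_mem_erase hj)]
  rw [h1, Matrix.trace]
  refine Finset.sum_congr rfl fun i _ => ?_
  rw [← Matrix.cramer_apply, Matrix.cramer_eq_adjugate_mulVec]
  rfl

lemma matDeriv_inv (hS : IsOpen S) (hq : q ∈ S)
    (hH : ∀ i j, ContDiffOn ℝ ∞ (fun p => H p i j) S) (hdet : ∀ p ∈ S, (H p).det ≠ 0) :
    matDeriv v (fun p => (H p)⁻¹) q = -((H q)⁻¹ * matDeriv v H q * (H q)⁻¹) := by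
  have hu : IsUnit (H q).det := (hdet q hq).isUnit
  have h1 : matDeriv v (fun p => (H p)⁻¹ * H p) q = 0 := by
    ext i j
    simp only [matDeriv, Matrix.of_apply, Matrix.zero_apply]
    rw [dirDeriv_congr (G := fun _ => (1 : Matrix ι ι ℝ) i j) hS hq, dirDeriv_const]
    intro p hp
    rw [Matrix.nonsing_inv_mul _ (hdet p hp).isUnit]
  rw [matDeriv_mul (fun i j => (ContDiffOn.matrix_inv hH hdet i j).differentiableAt_of_isOpen hS hq)
    (fun i j => (hH i j).differentiableAt_of_isOpen hS hq)] at h1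
  have h2 := congrArg (· * (H q)⁻¹) (eq_neg_of_add_eq_zero_left h1)
  simpa only [Matrix.mul_assoc, Matrix.neg_mul, Matrix.mul_nonsing_inv _ hu, Matrix.mul_one]
    using h2

lemma ContDiffOn.sqrt_abs_det (hH : ∀ i j, ContDiffOn ℝ ∞ (fun p => H p i j) S)
    (hdet : ∀ p ∈ S, (H p).det ≠ 0) :
    ContDiffOn ℝ ∞ (fun p => Real.sqrt |(H p).det|) S := by
  have h : ∀ p, Real.sqrt |(H p).det| = Real.sqrt (Real.sqrt ((H p).det ^ 2)) := fun p => by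
    rw [Real.sqrt_sq_eq_abs]
  simp only [h]
  have hd := ContDiffOn.matrix_det hH
  refine ContDiffOn.sqrt (ContDiffOn.sqrt (hd.pow 2) ?_) ?_
  · intro p hp; exact pow_ne_zero 2 (hdet p hp)
  · intro p hp; rw [Real.sqrt_sq_eq_abs]; exact abs_ne_zero.2 (hdet p hp)

lemma dirDeriv_sqrt_abs_det (hS : IsOpen S) (hq : q ∈ S)
    (hH : ∀ i j, ContDiffOn ℝ ∞ (fun p => H p i j) S) (hdet : ∀ p ∈ S, (H p).det ≠ 0) :
    dirDeriv v (fun p => Real.sqrt |(H p).det|) q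
      = 1 / 2 * Real.sqrt |(H q).det| * ((H q)⁻¹ * matDeriv v H q).trace := by
  have hd := (ContDiffOn.matrix_det hH).differentiableAt_of_isOpen hS hq
  have hne := hdet q hq
  have hpos : 0 < |(H q).det| := abs_pos.2 hne
  have hs := Real.sqrt_pos.2 hpos
  have hsq := Real.mul_self_sqrt hpos.le
  rw [dirDeriv_comp (A := fun x => Real.sqrt |x|) (F := fun p => (H p).det)
    ((hasDerivAt_abs hne).sqrt hpos.ne') hd,
    dirDeriv_det (fun i j => (hH i j).differentiableAt_of_isOpen hS hq), Matrix.inv_def,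
    Ring.inverse_eq_inv', Matrix.smul_mul, Matrix.trace_smul, smul_eq_mul]
  have hsign : (SignType.sign (H q).det : ℝ) * (H q).det = |(H q).det| := sign_mul_self _
  field_simp
  rw [mul_right_comm, hsign, sq, hsq]

end MatrixCalculus

section AmbientGeometry

/-- The pairing `Σ_{μν} g_{μν}(x) V^μ W^ν`. -/
def metricPairing {N : ℕ} (g : (Fin N → ℝ) → Fin N → Fin N → ℝ) (x V W : Fin N → ℝ) : ℝ :=
  ∑ μ, ∑ ν, g x μ ν * V μ * W ν

/-- `g` is a smooth pseudo-Riemannian metric on the open set `V`, in components. -/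
structure IsMetricOn {N : ℕ} (g : (Fin N → ℝ) → Fin N → Fin N → ℝ) (V : Set (Fin N → ℝ)) :
    Prop where
  isOpen : IsOpen V
  smooth : ∀ μ ν, ContDiffOn ℝ ∞ (fun x => g x μ ν) V
  symm : ∀ x ∈ V, ∀ μ ν, g x μ ν = g x ν μ
  isUnit : ∀ x ∈ V, IsUnit (Matrix.of (g x)).det

variable {N : ℕ} {g : (Fin N → ℝ) → Fin N → Fin N → ℝ} {V : Set (Fin N → ℝ)}

lemma metricPairing_eq_dotProduct (x A B : Fin N → ℝ) :
    metricPairing g x A B = A ⬝ᵥ (Matrix.of (g x) *ᵥ B) := by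
  simp only [metricPairing, dotProduct, Matrix.mulVec, Matrix.of_apply, Finset.mul_sum]
  exact Finset.sum_congr rfl fun _ _ => Finset.sum_congr rfl fun _ _ => by ring

lemma metricPairing_add_left (x A B C : Fin N → ℝ) :
    metricPairing g x (A + B) C = metricPairing g x A C + metricPairing g x B C := by
  simp [metricPairing_eq_dotProduct, add_dotProduct]

lemma metricPairing_smul_left (c : ℝ) (x A B : Fin N → ℝ) :
    metricPairing g x (c • A) B = c * metricPairing g x A B := by
  simp [metricPairing_eq_dotProduct]

lemma metricPairing_smul_right (c : ℝ) (x A B : Fin N → ℝ) :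
    metricPairing g x A (c • B) = c * metricPairing g x A B := by
  simp [metricPairing_eq_dotProduct, Matrix.mulVec_smul]

lemma metricPairing_add_right (x A B C : Fin N → ℝ) :
    metricPairing g x A (B + C) = metricPairing g x A B + metricPairing g x A C := by
  simp [metricPairing_eq_dotProduct, Matrix.mulVec_add]

lemma metricPairing_sum_left {ι : Type*} {s : Finset ι} (x : Fin N → ℝ) (A : ι → Fin N → ℝ)
    (B : Fin N → ℝ) :
    metricPairing g x (∑ i ∈ s, A i) B = ∑ i ∈ s, metricPairing g x (A i) B := by
  simp [metricPairing_eq_dotProduct, sum_dotProduct]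

namespace IsMetricOn

variable (hg : IsMetricOn g V)
include hg

lemma pairing_comm {x : Fin N → ℝ} (hx : x ∈ V) (A B : Fin N → ℝ) :
    metricPairing g x A B = metricPairing g x B A := by
  simp only [metricPairing]
  rw [Finset.sum_comm]
  exact Finset.sum_congr rfl fun μ _ => Finset.sum_congr rfl fun ν _ => by
    rw [hg.symm x hx ν μ]; ring

lemma pder_symm {x : Fin N → ℝ} (hx : x ∈ V) (μ ν σ : Fin N) :
    pder (fun z => g z μ ν) σ x = pder (fun z => g z ν μ) σ x :=
  dirDeriv_congr hg.isOpen hx fun z hz => hg.symm z hz μ ν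

lemma christoffel_symm {x : Fin N → ℝ} (hx : x ∈ V) (l μ ν : Fin N) :
    christoffel g x l μ ν = christoffel g x l ν μ := by
  simp only [christoffel]
  congr 1
  refine Finset.sum_congr rfl fun σ _ => ?_
  rw [hg.pder_symm hx μ ν σ]; ring

lemma lower_christoffel {x : Fin N → ℝ} (hx : x ∈ V) (s μ ν : Fin N) :
    ∑ l, g x s l * christoffel g x l μ ν = 1 / 2 *
      (pder (fun z => g z s ν) μ x + pder (fun z => g z s μ) ν x
        - pder (fun z => g z μ ν) s x) := by
  have h := Matrix.mul_nonsing_inv _ (hg.isUnit x hx)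
  have h' : ∀ σ, ∑ l, g x s l * ginv g x l σ = (1 : Matrix (Fin N) (Fin N) ℝ) s σ := by
    intro σ; rw [← h, Matrix.mul_apply]; rfl
  calc _ = 1 / 2 * ∑ σ, (∑ l, g x s l * ginv g x l σ) *
        (pder (fun z => g z σ ν) μ x + pder (fun z => g z σ μ) ν x
        - pder (fun z => g z μ ν) σ x) := by
        simp only [christoffel, Finset.mul_sum, Finset.sum_mul]
        rw [Finset.sum_comm]
        exact Finset.sum_congr rfl fun _ _ => Finset.sum_congr rfl fun _ _ => by ring
    _ = _ := by simp [h', Matrix.one_apply]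

lemma pder_eq {x : Fin N → ℝ} (hx : x ∈ V) (μ ν σ : Fin N) :
    pder (fun z => g z μ ν) σ x
      = ∑ l, g x μ l * christoffel g x l ν σ + ∑ l, g x ν l * christoffel g x l μ σ := by
  rw [hg.lower_christoffel hx, hg.lower_christoffel hx, hg.pder_symm hx ν μ, hg.pder_symm hx μ σ,
    hg.pder_symm hx ν σ, hg.pder_symm hx σ μ, hg.pder_symm hx σ ν]
  simp only [hg.pder_symm hx ν σ, hg.pder_symm hx μ σ]
  ring

lemma contDiffOn_christoffel (l μ ν : Fin N) :
    ContDiffOn ℝ ∞ (fun x => christoffel g x l μ ν) V := by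
  have hp : ∀ a b c, ContDiffOn ℝ ∞ (fun x => pder (fun z => g z a b) c x) V :=
    fun a b c => (hg.smooth a b).dirDeriv hg.isOpen _
  have hi : ∀ a b, ContDiffOn ℝ ∞ (fun x => ginv g x a b) V := fun a b =>
    ContDiffOn.matrix_inv (H := fun x => Matrix.of (g x)) hg.smooth
      (fun x hx => (hg.isUnit x hx).ne_zero) a b
  exact contDiffOn_const.mul (ContDiffOn.sum fun σ _ =>
    (hi _ _).mul (((hp _ _ _).add (hp _ _ _)).sub (hp _ _ _)))

end IsMetricOn

variable {E : Type*} [NormedAddCommGroup E] [NormedSpace ℝ E]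

/-- The vector `∂_v Φ` along the map `Φ`. -/
def tangentAlong (Φ : E → Fin N → ℝ) (v q : E) (l : Fin N) : ℝ :=
  dirDeriv v (fun p => Φ p l) q

/-- The covariant derivative in the direction `v` of a vector field `W` along the map `Φ`. -/
def covDeriv (g : (Fin N → ℝ) → Fin N → Fin N → ℝ) (Φ : E → Fin N → ℝ) (v : E)
    (W : E → Fin N → ℝ) (q : E) (ν : Fin N) : ℝ :=
  dirDeriv v (fun p => W p ν) q
    + ∑ l, ∑ σ, christoffel g (Φ q) ν l σ * tangentAlong Φ v q l * W q σ

/-- The matrix of the connection along `Φ` in the direction `v`. -/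
def connMatrix (g : (Fin N → ℝ) → Fin N → Fin N → ℝ) (Φ : E → Fin N → ℝ) (v q : E) :
    Matrix (Fin N) (Fin N) ℝ :=
  Matrix.of fun ν σ => ∑ l, christoffel g (Φ q) ν σ l * tangentAlong Φ v q l

/-- The curvature operator `R(u, r) W`. -/
def curvOp (g : (Fin N → ℝ) → Fin N → Fin N → ℝ) (x u r W : Fin N → ℝ) (l : Fin N) : ℝ :=
  ∑ α, ∑ μ, ∑ β, riemann g x l α μ β * u μ * r β * W α

/-- `Φ` is a smooth map from the open set `S` into `V`. -/
structure IsSmoothMap (Φ : E → Fin N → ℝ) (S : Set E) (V : Set (Fin N → ℝ)) : Prop where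
  isOpen : IsOpen S
  smooth : ∀ μ, ContDiffOn ℝ ∞ (fun p => Φ p μ) S
  mapsTo : ∀ p ∈ S, Φ p ∈ V

variable {Φ : E → Fin N → ℝ} {S : Set E} {q v w : E} {A B W : E → Fin N → ℝ}

lemma covDeriv_add (hA : ∀ μ, DifferentiableAt ℝ (fun p => A p μ) q)
    (hB : ∀ μ, DifferentiableAt ℝ (fun p => B p μ) q) :
    covDeriv g Φ v (fun p => A p + B p) q = covDeriv g Φ v A q + covDeriv g Φ v B q := by
  ext ν
  simp only [covDeriv, Pi.add_apply, dirDeriv_add (hA ν) (hB ν), mul_add, Finset.sum_add_distrib]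
  ring

lemma covDeriv_smul {F : E → ℝ} (hF : DifferentiableAt ℝ F q)
    (hA : ∀ μ, DifferentiableAt ℝ (fun p => A p μ) q) :
    covDeriv g Φ v (fun p => F p • A p) q = dirDeriv v F q • A q + F q • covDeriv g Φ v A q := by
  ext ν
  simp only [covDeriv, Pi.add_apply, Pi.smul_apply, smul_eq_mul, dirDeriv_mul hF (hA ν), mul_add,
    Finset.mul_sum]
  rw [add_assoc]
  congr 2
  exact Finset.sum_congr rfl fun _ _ => Finset.sum_congr rfl fun _ _ => by ring

lemma covDeriv_sum {ι : Type*} {s : Finset ι} {A : ι → E → Fin N → ℝ}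
    (hA : ∀ i ∈ s, ∀ μ, DifferentiableAt ℝ (fun p => A i p μ) q) :
    covDeriv g Φ v (fun p => ∑ i ∈ s, A i p) q = ∑ i ∈ s, covDeriv g Φ v (A i) q := by
  ext ν
  simp only [covDeriv, Finset.sum_apply, dirDeriv_sum (fun i hi => hA i hi ν), Finset.mul_sum,
    Finset.sum_add_distrib]
  congr 1
  rw [Finset.sum_comm]
  conv_rhs => rw [Finset.sum_comm]
  rw [Finset.sum_comm]
  refine Finset.sum_congr rfl fun _ _ => ?_
  rw [Finset.sum_comm]

lemma ContDiffOn.metricPairing (hg : IsMetricOn g V) (hΦ : IsSmoothMap Φ S V)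
    (hA : ∀ μ, ContDiffOn ℝ ∞ (fun p => A p μ) S) (hB : ∀ μ, ContDiffOn ℝ ∞ (fun p => B p μ) S) :
    ContDiffOn ℝ ∞ (fun p => metricPairing g (Φ p) (A p) (B p)) S :=
  ContDiffOn.sum fun μ _ => ContDiffOn.sum fun ν _ =>
    (((hg.smooth μ ν).comp (contDiffOn_pi.2 hΦ.smooth) hΦ.mapsTo).mul (hA μ)).mul (hB ν)

lemma ContDiffOn.covDeriv (hg : IsMetricOn g V) (hΦ : IsSmoothMap Φ S V)
    (hW : ∀ μ, ContDiffOn ℝ ∞ (fun p => W p μ) S) (v : E) (ν : Fin N) :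
    ContDiffOn ℝ ∞ (fun p => covDeriv g Φ v W p ν) S :=
  ((hW ν).dirDeriv hΦ.isOpen v).add <| ContDiffOn.sum fun l _ => ContDiffOn.sum fun σ _ =>
    (((hg.contDiffOn_christoffel ν l σ).comp (contDiffOn_pi.2 hΦ.smooth) hΦ.mapsTo).mul
      ((hΦ.smooth l).dirDeriv hΦ.isOpen v)).mul (hW σ)

lemma covDeriv_eq_connMatrix (hg : IsMetricOn g V) (hq : Φ q ∈ V) (ν : Fin N) :
    covDeriv g Φ v W q ν
      = dirDeriv v (fun p => W p ν) q + ∑ σ, connMatrix g Φ v q ν σ * W q σ := by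
  simp only [covDeriv, connMatrix, Matrix.of_apply, Finset.sum_mul]
  rw [Finset.sum_comm]
  simp only [hg.christoffel_symm hq ν]

theorem dirDeriv_metricPairing (hg : IsMetricOn g V) (hΦ : IsSmoothMap Φ S V) (hq : q ∈ S)
    (hA : ∀ μ, DifferentiableAt ℝ (fun p => A p μ) q)
    (hB : ∀ μ, DifferentiableAt ℝ (fun p => B p μ) q) :
    dirDeriv v (fun p => metricPairing g (Φ p) (A p) (B p)) q
      = metricPairing g (Φ q) (covDeriv g Φ v A q) (B q)
        + metricPairing g (Φ q) (A q) (covDeriv g Φ v B q) := by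
  have hx := hΦ.mapsTo q hq
  have hΦd := fun i => (hΦ.smooth i).differentiableAt_of_isOpen hΦ.isOpen hq
  have hgd : ∀ μ ν, DifferentiableAt ℝ (fun p => g (Φ p) μ ν) q := fun μ ν =>
    ((hg.smooth μ ν).comp (contDiffOn_pi.2 hΦ.smooth) hΦ.mapsTo).differentiableAt_of_isOpen
      hΦ.isOpen hq
  set C := connMatrix g Φ v q with hC
  set G := Matrix.of (g (Φ q)) with hG
  have hGt : Gᵀ = G := by ext i j; exact hg.symm _ hx j i
  have hdg : ∀ μ ν, dirDeriv v (fun p => g (Φ p) μ ν) q = (G * C + (G * C)ᵀ) μ ν := by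
    intro μ ν
    rw [dirDeriv_comp_coord (A := fun x => g x μ ν)
      ((hg.smooth μ ν).differentiableAt_of_isOpen hg.isOpen hx) hΦd]
    simp only [hg.pder_eq hx, Matrix.add_apply, Matrix.transpose_apply, Matrix.mul_apply, hG, hC,
      connMatrix, Matrix.of_apply, Finset.mul_sum, add_mul, Finset.sum_mul, Finset.sum_add_distrib]
    congr 1 <;>
    · rw [Finset.sum_comm]
      exact Finset.sum_congr rfl fun _ _ => Finset.sum_congr rfl fun _ _ => by
        simp only [tangentAlong]; ring
  have hcov : ∀ W : E → Fin N → ℝ, covDeriv g Φ v W q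
      = (fun ν => dirDeriv v (fun p => W p ν) q) + C *ᵥ W q := by
    intro W; ext ν; exact covDeriv_eq_connMatrix hg hx ν
  have hL : dirDeriv v (fun p => metricPairing g (Φ p) (A p) (B p)) q
      = A q ⬝ᵥ ((G * C + (G * C)ᵀ) *ᵥ B q)
        + metricPairing g (Φ q) (fun ν => dirDeriv v (fun p => A p ν) q) (B q)
        + metricPairing g (Φ q) (A q) (fun ν => dirDeriv v (fun p => B p ν) q) := by
    simp only [metricPairing, dotProduct, Matrix.mulVec, Finset.mul_sum, ← hdg]
    have hgA : ∀ μ ν, DifferentiableAt ℝ (fun p => g (Φ p) μ ν * A p μ) q :=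
      fun μ ν => (hgd μ ν).mul (hA μ)
    have hterm : ∀ μ ν, DifferentiableAt ℝ (fun p => g (Φ p) μ ν * A p μ * B p ν) q :=
      fun μ ν => (hgA μ ν).mul (hB ν)
    rw [dirDeriv_sum (fun μ _ => DifferentiableAt.fun_sum fun ν _ => hterm μ ν),
      ← Finset.sum_add_distrib, ← Finset.sum_add_distrib]
    refine Finset.sum_congr rfl fun μ _ => ?_
    rw [dirDeriv_sum (fun ν _ => hterm μ ν), ← Finset.sum_add_distrib, ← Finset.sum_add_distrib]
    refine Finset.sum_congr rfl fun ν _ => ?_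
    rw [dirDeriv_mul (hgA μ ν) (hB ν), dirDeriv_mul (hgd μ ν) (hA μ)]
    ring
  rw [hL, hcov A, hcov B, metricPairing_add_left, metricPairing_add_right]
  have h1 : metricPairing g (Φ q) (C *ᵥ A q) (B q) = A q ⬝ᵥ ((G * C)ᵀ *ᵥ B q) := by
    rw [metricPairing_eq_dotProduct, Matrix.transpose_mul, hGt, ← Matrix.mulVec_mulVec,
      Matrix.dotProduct_mulVec (A q), Matrix.vecMul_transpose]
  have h2 : metricPairing g (Φ q) (A q) (C *ᵥ B q) = A q ⬝ᵥ ((G * C) *ᵥ B q) := by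
    rw [metricPairing_eq_dotProduct, Matrix.mulVec_mulVec]
  rw [h1, h2, Matrix.add_mulVec, dotProduct_add]
  ring

theorem covDeriv_tangentAlong_comm (hg : IsMetricOn g V) (hΦ : IsSmoothMap Φ S V) (hq : q ∈ S) :
    covDeriv g Φ v (tangentAlong Φ w) q = covDeriv g Φ w (tangentAlong Φ v) q := by
  ext ν
  simp only [covDeriv]
  congr 1
  · exact dirDeriv_comm (hΦ.smooth ν) hΦ.isOpen hq
  · rw [Finset.sum_comm]
    exact Finset.sum_congr rfl fun _ _ => Finset.sum_congr rfl fun _ _ => by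
      rw [hg.christoffel_symm (hΦ.mapsTo q hq)]; ring

lemma ContDiffOn.connMatrix (hg : IsMetricOn g V) (hΦ : IsSmoothMap Φ S V) (v : E)
    (μ α : Fin N) : ContDiffOn ℝ ∞ (fun p => connMatrix g Φ v p μ α) S := by
  simp only [_root_.connMatrix, Matrix.of_apply]
  exact ContDiffOn.sum fun l _ =>
    ((hg.contDiffOn_christoffel μ α l).comp (contDiffOn_pi.2 hΦ.smooth) hΦ.mapsTo).mul
      ((hΦ.smooth l).dirDeriv hΦ.isOpen v)

lemma dirDeriv_connMatrix (hg : IsMetricOn g V) (hΦ : IsSmoothMap Φ S V) (hq : q ∈ S)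
    (μ α : Fin N) :
    dirDeriv v (fun p => connMatrix g Φ w p μ α) q
      = (∑ ν, ∑ β, pder (fun z => christoffel g z μ α β) ν (Φ q) * tangentAlong Φ v q ν
          * tangentAlong Φ w q β)
        + ∑ β, christoffel g (Φ q) μ α β * dirDeriv v (fun p => tangentAlong Φ w p β) q := by
  have hΦd := fun i => (hΦ.smooth i).differentiableAt_of_isOpen hΦ.isOpen hq
  have hc : ∀ β, DifferentiableAt ℝ (fun p => christoffel g (Φ p) μ α β) q := fun β =>
    ((hg.contDiffOn_christoffel μ α β).comp (contDiffOn_pi.2 hΦ.smooth)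
      hΦ.mapsTo).differentiableAt_of_isOpen hΦ.isOpen hq
  have ht : ∀ β, DifferentiableAt ℝ (fun p => tangentAlong Φ w p β) q := fun β =>
    ((hΦ.smooth β).dirDeriv hΦ.isOpen w).differentiableAt_of_isOpen hΦ.isOpen hq
  simp only [_root_.connMatrix, Matrix.of_apply]
  rw [dirDeriv_sum (fun β _ => by fun_prop), Finset.sum_comm, ← Finset.sum_add_distrib]
  refine Finset.sum_congr rfl fun β _ => ?_
  rw [dirDeriv_mul (hc β) (ht β), dirDeriv_comp_coord (A := fun z => christoffel g z μ α β)
    ((hg.contDiffOn_christoffel μ α β).differentiableAt_of_isOpen hg.isOpen (hΦ.mapsTo q hq)) hΦd,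
    Finset.sum_mul]
  rfl

theorem covDeriv_comm (hg : IsMetricOn g V) (hΦ : IsSmoothMap Φ S V) (hq : q ∈ S)
    (hW : ∀ μ, ContDiffOn ℝ ∞ (fun p => W p μ) S) :
    covDeriv g Φ v (covDeriv g Φ w W) q
      = covDeriv g Φ w (covDeriv g Φ v W) q
        + curvOp g (Φ q) (tangentAlong Φ v q) (tangentAlong Φ w q) (W q) := by
  have hx := hΦ.mapsTo q hq
  have hd : ∀ (v : E) (μ α : Fin N), DifferentiableAt ℝ (fun p => connMatrix g Φ v p μ α) q :=
    fun v μ α => (ContDiffOn.connMatrix hg hΦ v μ α).differentiableAt_of_isOpen hΦ.isOpen hq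
  have hWd := fun μ => (hW μ).differentiableAt_of_isOpen hΦ.isOpen hq
  have hWd' : ∀ (v : E) μ, DifferentiableAt ℝ (fun p => dirDeriv v (fun p => W p μ) p) q :=
    fun v μ => ((hW μ).dirDeriv hΦ.isOpen v).differentiableAt_of_isOpen hΦ.isOpen hq
  have expand : ∀ (v w : E) μ, covDeriv g Φ v (covDeriv g Φ w W) q μ
      = dirDeriv v (dirDeriv w (fun p => W p μ)) q
        + ∑ α, dirDeriv v (fun p => connMatrix g Φ w p μ α) q * W q α
        + ∑ α, connMatrix g Φ w q μ α * dirDeriv v (fun p => W p α) q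
        + ∑ α, connMatrix g Φ v q μ α * dirDeriv w (fun p => W p α) q
        + ∑ α, (connMatrix g Φ v q * connMatrix g Φ w q) μ α * W q α := by
    intro v w μ
    rw [covDeriv_eq_connMatrix hg hx, dirDeriv_congr hΦ.isOpen hq
      (fun p hp => covDeriv_eq_connMatrix hg (hΦ.mapsTo p hp) μ),
      dirDeriv_add (hWd' w μ) (by fun_prop), dirDeriv_sum (fun α _ => by fun_prop)]
    simp only [covDeriv_eq_connMatrix hg hx, dirDeriv_mul (hd w _ _) (hWd _), mul_add,
      Finset.sum_add_distrib, Matrix.mul_apply, Finset.sum_mul, Finset.mul_sum]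
    rw [Finset.sum_comm (f := fun i j => connMatrix g Φ v q μ j * connMatrix g Φ w q j i * W q i)]
    simp only [mul_assoc]
    change dirDeriv v (dirDeriv w fun p => W p μ) q + _ + _ = _
    ring
  ext μ
  rw [Pi.add_apply, expand v w, expand w v, dirDeriv_comm (hW μ) hΦ.isOpen hq (v := v)]
  have hcurv : curvOp g (Φ q) (tangentAlong Φ v q) (tangentAlong Φ w q) (W q) μ
      = ∑ α, (dirDeriv v (fun p => connMatrix g Φ w p μ α) q
        - dirDeriv w (fun p => connMatrix g Φ v p μ α) q
        + (connMatrix g Φ v q * connMatrix g Φ w q) μ α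
        - (connMatrix g Φ w q * connMatrix g Φ v q) μ α) * W q α := by
    refine Finset.sum_congr rfl fun α _ => ?_
    have hcomm : ∀ β, dirDeriv v (fun p => tangentAlong Φ w p β) q
        = dirDeriv w (fun p => tangentAlong Φ v p β) q :=
      fun β => dirDeriv_comm (hΦ.smooth β) hΦ.isOpen hq
    have hquad : ∀ v w : E, (connMatrix g Φ v q * connMatrix g Φ w q) μ α
        = ∑ ν, ∑ β, (∑ σ, christoffel g (Φ q) μ σ ν * christoffel g (Φ q) σ α β)
          * tangentAlong Φ v q ν * tangentAlong Φ w q β := by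
      intro v w
      simp only [Matrix.mul_apply, connMatrix, Matrix.of_apply, Finset.sum_mul, Finset.mul_sum]
      rw [Finset.sum_comm]
      conv_lhs => enter [2, β]; rw [Finset.sum_comm]
      rw [Finset.sum_comm]
      refine Finset.sum_congr rfl fun ν _ => Finset.sum_congr rfl fun β _ =>
        Finset.sum_congr rfl fun σ _ => by ring
    have hswap : ∀ T : Fin N → Fin N → ℝ,
        ∑ ν, ∑ β, T ν β * tangentAlong Φ w q ν * tangentAlong Φ v q β
          = ∑ ν, ∑ β, T β ν * tangentAlong Φ v q ν * tangentAlong Φ w q β := by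
      intro T
      rw [Finset.sum_comm]
      exact Finset.sum_congr rfl fun _ _ => Finset.sum_congr rfl fun _ _ => by ring
    rw [dirDeriv_connMatrix hg hΦ hq, dirDeriv_connMatrix hg hΦ hq, hquad v w, hquad w v, hswap,
      hswap]
    simp only [hcomm, riemann, Finset.sum_sub_distrib, add_mul, sub_mul, Finset.sum_add_distrib,
      Finset.sum_mul]
    ring
  rw [hcurv]
  simp only [add_mul, sub_mul, Finset.sum_add_distrib, Finset.sum_sub_distrib]
  ring

end AmbientGeometry

section AdaptedFrame

variable {n : ℕ} {g : (Fin (n + 1) → ℝ) → Fin (n + 1) → Fin (n + 1) → ℝ}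
  {V : Set (Fin (n + 1) → ℝ)} {x : Fin (n + 1) → ℝ} {e : Fin n → Fin (n + 1) → ℝ}
  {u : Fin (n + 1) → ℝ} {ϵ : ℝ}

/-- The Gram matrix of the vectors `e a`. -/
def gramMatrix (g : (Fin (n + 1) → ℝ) → Fin (n + 1) → Fin (n + 1) → ℝ) (x : Fin (n + 1) → ℝ)
    (e : Fin n → Fin (n + 1) → ℝ) : Matrix (Fin n) (Fin n) ℝ :=
  Matrix.of fun a b => metricPairing g x (e a) (e b)

/-- The inverse metric in terms of `n` vectors and a unit normal to them. -/
lemma ginv_eq_of_frame (hg : IsMetricOn g V) (hx : x ∈ V)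
    (horth : ∀ a, metricPairing g x u (e a) = 0) (hunit : metricPairing g x u u = ϵ)
    (hϵ : ϵ * ϵ = 1) (hdet : (gramMatrix g x e).det ≠ 0) (l m : Fin (n + 1)) :
    ginv g x l m = ∑ a, ∑ b, (gramMatrix g x e)⁻¹ a b * e a l * e b m + ϵ * u l * u m := by
  set G := Matrix.of (g x) with hG
  set Hi := (gramMatrix g x e)⁻¹ with hHi
  let F : Matrix (Fin n ⊕ Unit) (Fin (n + 1)) ℝ := Matrix.of (Sum.elim e fun _ => u)
  let D : Matrix (Fin n ⊕ Unit) (Fin n ⊕ Unit) ℝ :=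
    Matrix.fromBlocks Hi 0 0 (Matrix.of fun _ _ => ϵ)
  have hF : ∀ i j, (F * G * Fᵀ) i j = metricPairing g x (F i) (F j) := by
    intro i j
    rw [metricPairing_eq_dotProduct, Matrix.dotProduct_mulVec, Matrix.mul_apply]
    rfl
  have hgram : F * G * Fᵀ
      = Matrix.fromBlocks (gramMatrix g x e) 0 0 (Matrix.of fun _ _ => ϵ) := by
    ext i j
    rw [hF]
    rcases i with a | a <;> rcases j with b | b
    · rfl
    · change metricPairing g x (e a) u = 0
      rw [hg.pairing_comm hx, horth]
    · exact horth b
    · exact hunit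
  have h1 : (D * F * G) * Fᵀ = 1 := by
    rw [Matrix.mul_assoc D, Matrix.mul_assoc D, hgram, Matrix.fromBlocks_multiply,
      Matrix.nonsing_inv_mul _ hdet.isUnit, ← Matrix.fromBlocks_one]
    congr 1 <;> ext i j <;> simp [Matrix.mul_apply, hϵ]
  have h2 : Fᵀ * (D * F * G) = 1 :=
    (Matrix.mul_eq_one_comm_of_card_eq _ _ _ (by simp)).1 h1
  have h3 : G⁻¹ = Fᵀ * (D * F) := by
    refine Matrix.inv_eq_left_inv ?_
    rw [← h2, Matrix.mul_assoc]
  change G⁻¹ l m = _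
  rw [h3, Matrix.mul_apply]
  simp only [Matrix.mul_apply, Fintype.sum_sum_type, F, D, Matrix.transpose_apply,
    Matrix.of_apply, Sum.elim_inl, Sum.elim_inr, Matrix.fromBlocks_apply₁₁,
    Matrix.fromBlocks_apply₁₂, Matrix.fromBlocks_apply₂₁, Matrix.fromBlocks_apply₂₂,
    Matrix.zero_apply, zero_mul, Finset.sum_const_zero, add_zero, zero_add, Finset.mul_sum]
  congr 1
  · exact Finset.sum_congr rfl fun _ _ => Finset.sum_congr rfl fun _ _ => by ring
  · simp; ring

lemma sum_mul_ginv (hg : IsMetricOn g V) (hx : x ∈ V) (l m : Fin (n + 1)) :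
    ∑ s, g x s l * ginv g x s m = if l = m then 1 else 0 := by
  have h := Matrix.mul_nonsing_inv _ (hg.isUnit x hx)
  rw [← Matrix.one_apply, ← h, Matrix.mul_apply]
  exact Finset.sum_congr rfl fun s _ => by rw [hg.symm x hx s l]; rfl

/-- The trace of an endomorphism computed in a frame. -/
lemma trace_eq_of_frame (hg : IsMetricOn g V) (hx : x ∈ V)
    (horth : ∀ a, metricPairing g x u (e a) = 0) (hunit : metricPairing g x u u = ϵ)
    (hϵ : ϵ * ϵ = 1) (hdet : (gramMatrix g x e).det ≠ 0)
    (T : Matrix (Fin (n + 1)) (Fin (n + 1)) ℝ) :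
    T.trace = ∑ a, ∑ b, (gramMatrix g x e)⁻¹ a b * metricPairing g x (e a) (T *ᵥ e b)
      + ϵ * metricPairing g x u (T *ᵥ u) := by
  have h1 : ∀ A B : Fin (n + 1) → ℝ, metricPairing g x A (T *ᵥ B)
      = ∑ l, ∑ m, T l m * ∑ s, g x s l * (A s * B m) := by
    intro A B
    simp only [metricPairing, Matrix.mulVec, dotProduct, Finset.mul_sum]
    rw [Finset.sum_comm]
    refine Finset.sum_congr rfl fun l _ => ?_
    rw [Finset.sum_comm]
    exact Finset.sum_congr rfl fun _ _ => Finset.sum_congr rfl fun _ _ => by ring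
  have h2 : T.trace = ∑ l, ∑ m, T l m * ∑ s, g x s l * ginv g x s m := by
    simp [sum_mul_ginv hg hx, Matrix.trace]
  rw [h2]
  simp only [h1, ginv_eq_of_frame hg hx horth hunit hϵ hdet, mul_add, Finset.mul_sum,
    Finset.sum_add_distrib]
  congr 1
  · conv_rhs => enter [2, a]; rw [Finset.sum_comm]
    rw [Finset.sum_comm]
    conv_rhs => rw [Finset.sum_comm]
    rw [Finset.sum_comm]
    refine Finset.sum_congr rfl fun l _ => ?_
    conv_rhs => enter [2, a]; rw [Finset.sum_comm]
    rw [Finset.sum_comm (s := Finset.univ (α := Fin n))]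
    refine Finset.sum_congr rfl fun m _ => ?_
    conv_rhs => enter [2, a]; rw [Finset.sum_comm]
    rw [Finset.sum_comm (s := Finset.univ (α := Fin n))]
    exact Finset.sum_congr rfl fun _ _ => Finset.sum_congr rfl fun _ _ =>
      Finset.sum_congr rfl fun _ _ => by ring
  · exact Finset.sum_congr rfl fun _ _ => Finset.sum_congr rfl fun _ _ =>
      Finset.sum_congr rfl fun _ _ => by ring

/-- The pairing of two vectors in terms of their components in a frame. -/
lemma metricPairing_eq_of_frame (hg : IsMetricOn g V) (hx : x ∈ V)
    (horth : ∀ a, metricPairing g x u (e a) = 0) (hunit : metricPairing g x u u = ϵ)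
    (hϵ : ϵ * ϵ = 1) (hdet : (gramMatrix g x e).det ≠ 0) (A B : Fin (n + 1) → ℝ) :
    metricPairing g x A B
      = ∑ a, ∑ b, (gramMatrix g x e)⁻¹ a b * metricPairing g x (e a) A * metricPairing g x (e b) B
        + ϵ * metricPairing g x u A * metricPairing g x u B := by
  have hT : ∀ C, Matrix.vecMulVec A (Matrix.of (g x) *ᵥ B) *ᵥ C
      = metricPairing g x C B • A := by
    intro C
    rw [Matrix.vecMulVec_mulVec, metricPairing_eq_dotProduct, dotProduct_comm]
    ext i; simp [mul_comm]
  have h := trace_eq_of_frame hg hx horth hunit hϵ hdet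
    (Matrix.vecMulVec A (Matrix.of (g x) *ᵥ B))
  rw [Matrix.trace_vecMulVec, ← metricPairing_eq_dotProduct] at h
  rw [h]
  simp only [hT, metricPairing_smul_right]
  congr 1
  · exact Finset.sum_congr rfl fun _ _ => Finset.sum_congr rfl fun _ _ => by ring
  · ring

lemma curvOp_swap {N : ℕ} (g : (Fin N → ℝ) → Fin N → Fin N → ℝ) (x u r W : Fin N → ℝ) :
    curvOp g x u r W = -curvOp g x r u W := by
  ext l
  simp only [curvOp, Pi.neg_apply, ← Finset.sum_neg_distrib]
  refine Finset.sum_congr rfl fun α _ => ?_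
  rw [Finset.sum_comm]
  refine Finset.sum_congr rfl fun μ _ => Finset.sum_congr rfl fun β _ => ?_
  have h : riemann g x l α β μ = -riemann g x l α μ β := by
    simp only [riemann, neg_add, neg_sub, ← Finset.sum_neg_distrib]
  rw [h]; ring

/-- The Ricci curvature in the normal direction as a trace over the tangent vectors. -/
lemma ricci_eq_of_frame (hg : IsMetricOn g V) (hx : x ∈ V)
    (horth : ∀ a, metricPairing g x u (e a) = 0) (hunit : metricPairing g x u u = ϵ)
    (hϵ : ϵ * ϵ = 1) (hdet : (gramMatrix g x e).det ≠ 0) :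
    ∑ a, ∑ b, (gramMatrix g x e)⁻¹ a b * metricPairing g x (e a) (curvOp g x u (e b) u)
      = -∑ α, ∑ β, ricci g x α β * u α * u β := by
  let T : Matrix (Fin (n + 1)) (Fin (n + 1)) ℝ :=
    Matrix.of fun l m => ∑ α, ∑ β, riemann g x l α m β * u β * u α
  have hT : ∀ r, T *ᵥ r = curvOp g x r u u := by
    intro r
    ext l
    simp only [T, Matrix.mulVec, dotProduct, Matrix.of_apply, curvOp, Finset.sum_mul]
    rw [Finset.sum_comm]
    exact Finset.sum_congr rfl fun _ _ => Finset.sum_congr rfl fun _ _ =>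
      Finset.sum_congr rfl fun _ _ => by ring
  have h0 : curvOp g x u u u = 0 := self_eq_neg.1 (curvOp_swap g x u u u)
  have htr : T.trace = ∑ α, ∑ β, ricci g x α β * u α * u β := by
    simp only [T, Matrix.trace, Matrix.diag, Matrix.of_apply, ricci, Finset.sum_mul]
    rw [Finset.sum_comm]
    refine Finset.sum_congr rfl fun _ _ => ?_
    rw [Finset.sum_comm]
    exact Finset.sum_congr rfl fun _ _ => Finset.sum_congr rfl fun _ _ => by ring
  have h := trace_eq_of_frame hg hx horth hunit hϵ hdet T
  have hz : metricPairing g x u (0 : Fin (n + 1) → ℝ) = 0 := by simp [metricPairing]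
  rw [htr, hT u, h0, hz, mul_zero, add_zero] at h
  rw [h, ← Finset.sum_neg_distrib]
  refine Finset.sum_congr rfl fun a _ => ?_
  rw [← Finset.sum_neg_distrib]
  refine Finset.sum_congr rfl fun b _ => ?_
  rw [hT, curvOp_swap g x u (e b), ← neg_one_smul ℝ (curvOp g x (e b) u u),
    metricPairing_smul_right]
  ring

end AdaptedFrame

section HypersurfaceFamily

variable {n : ℕ} {E : Type*} [NormedAddCommGroup E] [NormedSpace ℝ E]

/-- A smooth map `Φ` with a unit normal field `ν` to the nondegenerate `n`-planes spanned by the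
derivatives of `Φ` in the directions `d a`. -/
structure IsHypersurfaceFamily (g : (Fin (n + 1) → ℝ) → Fin (n + 1) → Fin (n + 1) → ℝ)
    (V : Set (Fin (n + 1) → ℝ)) (Φ : E → Fin (n + 1) → ℝ) (S : Set E) (d : Fin n → E)
    (ν : E → Fin (n + 1) → ℝ) (ϵ : ℝ) : Prop where
  metric : IsMetricOn g V
  map : IsSmoothMap Φ S V
  smooth_normal : ∀ μ, ContDiffOn ℝ ∞ (fun p => ν p μ) S
  orth : ∀ p ∈ S, ∀ a, metricPairing g (Φ p) (ν p) (tangentAlong Φ (d a) p) = 0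
  unit : ∀ p ∈ S, metricPairing g (Φ p) (ν p) (ν p) = ϵ
  sign_sq : ϵ * ϵ = 1
  det_ne : ∀ p ∈ S, (gramMatrix g (Φ p) fun a => tangentAlong Φ (d a) p).det ≠ 0

/-- The first fundamental form. -/
def firstForm (g : (Fin (n + 1) → ℝ) → Fin (n + 1) → Fin (n + 1) → ℝ) (Φ : E → Fin (n + 1) → ℝ)
    (d : Fin n → E) (p : E) : Matrix (Fin n) (Fin n) ℝ :=
  gramMatrix g (Φ p) fun a => tangentAlong Φ (d a) p

/-- The second fundamental form. -/
def secondForm (g : (Fin (n + 1) → ℝ) → Fin (n + 1) → Fin (n + 1) → ℝ) (Φ : E → Fin (n + 1) → ℝ)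
    (d : Fin n → E) (ν : E → Fin (n + 1) → ℝ) (p : E) : Matrix (Fin n) (Fin n) ℝ :=
  Matrix.of fun a b => metricPairing g (Φ p) (tangentAlong Φ (d a) p) (covDeriv g Φ (d b) ν p)

/-- The Christoffel symbols of the first kind `⟨D_b e_a, e_c⟩` of the first fundamental form. -/
def lowerChristoffelInd (g : (Fin (n + 1) → ℝ) → Fin (n + 1) → Fin (n + 1) → ℝ)
    (Φ : E → Fin (n + 1) → ℝ) (d : Fin n → E) (p : E) (b a c : Fin n) : ℝ :=
  metricPairing g (Φ p) (covDeriv g Φ (d b) (tangentAlong Φ (d a)) p) (tangentAlong Φ (d c) p)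

namespace IsHypersurfaceFamily

variable {g : (Fin (n + 1) → ℝ) → Fin (n + 1) → Fin (n + 1) → ℝ}
  {V : Set (Fin (n + 1) → ℝ)} {Φ : E → Fin (n + 1) → ℝ} {S : Set E} {d : Fin n → E}
  {ν : E → Fin (n + 1) → ℝ} {ϵ : ℝ} {q v : E}
  (F : IsHypersurfaceFamily g V Φ S d ν ϵ)
include F

lemma contDiffOn_tangentAlong (v : E) (μ : Fin (n + 1)) :
    ContDiffOn ℝ ∞ (fun p => tangentAlong Φ v p μ) S :=
  (F.map.smooth μ).dirDeriv F.map.isOpen v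

lemma differentiableAt_tangentAlong (hq : q ∈ S) (v : E) (μ : Fin (n + 1)) :
    DifferentiableAt ℝ (fun p => tangentAlong Φ v p μ) q :=
  (F.contDiffOn_tangentAlong v μ).differentiableAt_of_isOpen F.map.isOpen hq

lemma differentiableAt_normal (hq : q ∈ S) (μ : Fin (n + 1)) :
    DifferentiableAt ℝ (fun p => ν p μ) q :=
  (F.smooth_normal μ).differentiableAt_of_isOpen F.map.isOpen hq

lemma differentiableAt_covDeriv_normal (hq : q ∈ S) (v : E) (μ : Fin (n + 1)) :
    DifferentiableAt ℝ (fun p => covDeriv g Φ v ν p μ) q :=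
  (ContDiffOn.covDeriv F.metric F.map F.smooth_normal v μ).differentiableAt_of_isOpen
    F.map.isOpen hq

lemma pairing_comm (hq : q ∈ S) (A B : Fin (n + 1) → ℝ) :
    metricPairing g (Φ q) A B = metricPairing g (Φ q) B A :=
  F.metric.pairing_comm (F.map.mapsTo q hq) A B

lemma contDiffOn_firstForm (a b : Fin n) : ContDiffOn ℝ ∞ (fun p => firstForm g Φ d p a b) S :=
  ContDiffOn.metricPairing F.metric F.map (F.contDiffOn_tangentAlong _)
    (F.contDiffOn_tangentAlong _)

lemma contDiffOn_secondForm (a b : Fin n) :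
    ContDiffOn ℝ ∞ (fun p => secondForm g Φ d ν p a b) S :=
  ContDiffOn.metricPairing F.metric F.map (F.contDiffOn_tangentAlong _)
    (ContDiffOn.covDeriv F.metric F.map F.smooth_normal _)

lemma contDiffOn_inv_firstForm (a b : Fin n) :
    ContDiffOn ℝ ∞ (fun p => (firstForm g Φ d p)⁻¹ a b) S :=
  ContDiffOn.matrix_inv F.contDiffOn_firstForm F.det_ne a b

lemma contDiffOn_sqrt_abs_det_firstForm :
    ContDiffOn ℝ ∞ (fun p => Real.sqrt |(firstForm g Φ d p).det|) S :=
  ContDiffOn.sqrt_abs_det F.contDiffOn_firstForm F.det_ne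

lemma contDiffOn_trace :
    ContDiffOn ℝ ∞ (fun p => ((firstForm g Φ d p)⁻¹ * secondForm g Φ d ν p).trace) S := by
  simp only [Matrix.trace, Matrix.diag, Matrix.mul_apply]
  exact ContDiffOn.sum fun a _ => ContDiffOn.sum fun b _ =>
    (F.contDiffOn_inv_firstForm a b).mul (F.contDiffOn_secondForm b a)

lemma pairing_normal_covDeriv_normal (hq : q ∈ S) :
    metricPairing g (Φ q) (ν q) (covDeriv g Φ v ν q) = 0 := by
  have h := dirDeriv_metricPairing (v := v) F.metric F.map hq (F.differentiableAt_normal hq)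
    (F.differentiableAt_normal hq)
  rw [dirDeriv_congr F.map.isOpen hq F.unit, dirDeriv_const, F.pairing_comm hq (covDeriv _ _ _ _ _)]
    at h
  linarith

lemma pairing_tangent_covDeriv_normal (hq : q ∈ S) (a : Fin n) :
    metricPairing g (Φ q) (tangentAlong Φ (d a) q) (covDeriv g Φ v ν q)
      = -metricPairing g (Φ q) (ν q) (covDeriv g Φ (d a) (tangentAlong Φ v) q) := by
  have h := dirDeriv_metricPairing (v := v) F.metric F.map hq (F.differentiableAt_normal hq)
    (F.differentiableAt_tangentAlong hq (d a))
  rw [dirDeriv_congr F.map.isOpen hq (fun p hp => F.orth p hp a), dirDeriv_const,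
    F.pairing_comm hq (covDeriv _ _ _ _ _), covDeriv_tangentAlong_comm F.metric F.map hq] at h
  linarith

lemma firstForm_symm (hq : q ∈ S) : (firstForm g Φ d q)ᵀ = firstForm g Φ d q := by
  ext a b; exact F.pairing_comm hq _ _

lemma secondForm_symm (hq : q ∈ S) : (secondForm g Φ d ν q)ᵀ = secondForm g Φ d ν q := by
  ext a b
  simp only [secondForm, Matrix.transpose_apply, Matrix.of_apply,
    F.pairing_tangent_covDeriv_normal hq]
  rw [covDeriv_tangentAlong_comm F.metric F.map hq]

lemma lowerChristoffelInd_symm (hq : q ∈ S) (a b c : Fin n) :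
    lowerChristoffelInd g Φ d q a b c = lowerChristoffelInd g Φ d q b a c := by
  simp only [lowerChristoffelInd]
  rw [covDeriv_tangentAlong_comm F.metric F.map hq]

lemma matDeriv_firstForm (hq : q ∈ S) (a b : Fin n) :
    matDeriv v (firstForm g Φ d) q a b
      = metricPairing g (Φ q) (covDeriv g Φ (d a) (tangentAlong Φ v) q) (tangentAlong Φ (d b) q)
        + metricPairing g (Φ q) (covDeriv g Φ (d b) (tangentAlong Φ v) q)
          (tangentAlong Φ (d a) q) := by
  have h := dirDeriv_metricPairing (v := v) F.metric F.map hq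
    (F.differentiableAt_tangentAlong hq (d a)) (F.differentiableAt_tangentAlong hq (d b))
  rw [covDeriv_tangentAlong_comm F.metric F.map hq (v := v),
    covDeriv_tangentAlong_comm F.metric F.map hq (v := v),
    F.pairing_comm hq (tangentAlong _ _ _)] at h
  exact h

lemma matDeriv_firstForm_tangent (hq : q ∈ S) (a b c : Fin n) :
    matDeriv (d c) (firstForm g Φ d) q a b
      = lowerChristoffelInd g Φ d q c a b + lowerChristoffelInd g Φ d q c b a := by
  rw [F.matDeriv_firstForm hq, F.lowerChristoffelInd_symm hq c a,
    F.lowerChristoffelInd_symm hq c b]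
  rfl

lemma matDeriv_secondForm (hq : q ∈ S) (a b : Fin n) :
    matDeriv v (secondForm g Φ d ν) q a b
      = metricPairing g (Φ q) (covDeriv g Φ (d a) (tangentAlong Φ v) q) (covDeriv g Φ (d b) ν q)
        + metricPairing g (Φ q) (tangentAlong Φ (d a) q)
            (covDeriv g Φ (d b) (covDeriv g Φ v ν) q)
        + metricPairing g (Φ q) (tangentAlong Φ (d a) q)
            (curvOp g (Φ q) (tangentAlong Φ v q) (tangentAlong Φ (d b) q) (ν q)) := by
  have h := dirDeriv_metricPairing (v := v) F.metric F.map hq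
    (F.differentiableAt_tangentAlong hq (d a)) (F.differentiableAt_covDeriv_normal hq (d b))
  rw [covDeriv_tangentAlong_comm F.metric F.map hq (v := v),
    covDeriv_comm F.metric F.map hq F.smooth_normal, metricPairing_add_right, ← add_assoc] at h
  exact h

lemma pairing_eq (hq : q ∈ S) (A B : Fin (n + 1) → ℝ) :
    metricPairing g (Φ q) A B
      = ∑ a, ∑ b, (firstForm g Φ d q)⁻¹ a b * metricPairing g (Φ q) (tangentAlong Φ (d a) q) A
          * metricPairing g (Φ q) (tangentAlong Φ (d b) q) B
        + ϵ * metricPairing g (Φ q) (ν q) A * metricPairing g (Φ q) (ν q) B :=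
  metricPairing_eq_of_frame F.metric (F.map.mapsTo q hq) (F.orth q hq) (F.unit q hq) F.sign_sq
    (F.det_ne q hq) A B

lemma dirDeriv_sqrt_abs_det (hq : q ∈ S) :
    dirDeriv v (fun p => Real.sqrt |(firstForm g Φ d p).det|) q
      = 1 / 2 * Real.sqrt |(firstForm g Φ d q).det|
        * ((firstForm g Φ d q)⁻¹ * matDeriv v (firstForm g Φ d) q).trace :=
  _root_.dirDeriv_sqrt_abs_det F.map.isOpen hq F.contDiffOn_firstForm F.det_ne

lemma inv_firstForm_symm (hq : q ∈ S) :
    ((firstForm g Φ d q)⁻¹)ᵀ = (firstForm g Φ d q)⁻¹ := by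
  rw [Matrix.transpose_nonsing_inv, F.firstForm_symm hq]

/-- The divergence of the inverse metric density, in terms of Christoffel symbols. -/
lemma divergence_inv_density (hq : q ∈ S) (w : Fin n → ℝ) :
    ∑ a, ∑ b, dirDeriv (d a)
        (fun p => Real.sqrt |(firstForm g Φ d p).det| * (firstForm g Φ d p)⁻¹ a b) q * w b
      = -(Real.sqrt |(firstForm g Φ d q).det| * ∑ a, ∑ b, (firstForm g Φ d q)⁻¹ a b
          * ∑ c, ∑ e, (firstForm g Φ d q)⁻¹ c e * lowerChristoffelInd g Φ d q b a c * w e) := by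
  set s := Real.sqrt |(firstForm g Φ d q).det| with hs
  set Hi := (firstForm g Φ d q)⁻¹ with hHi
  set A := lowerChristoffelInd g Φ d q with hA
  have hsymm : ∀ a b, Hi a b = Hi b a := fun a b => congrFun₂ (F.inv_firstForm_symm hq) b a
  have hAs : ∀ a b c, A a b c = A b a c := fun a b c => F.lowerChristoffelInd_symm hq a b c
  have h1 : ∀ a b, dirDeriv (d a)
      (fun p => Real.sqrt |(firstForm g Φ d p).det| * (firstForm g Φ d p)⁻¹ a b) q
      = s * ((∑ i, ∑ j, Hi i j * A a i j) * Hi a b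
        - ∑ i, ∑ j, Hi a i * (A a i j + A a j i) * Hi j b) := by
    intro a b
    rw [dirDeriv_mul (F.contDiffOn_sqrt_abs_det_firstForm.differentiableAt_of_isOpen F.map.isOpen hq)
      ((F.contDiffOn_inv_firstForm a b).differentiableAt_of_isOpen F.map.isOpen hq),
      F.dirDeriv_sqrt_abs_det hq]
    have h2 : dirDeriv (d a) (fun p => (firstForm g Φ d p)⁻¹ a b) q
        = -(Hi * matDeriv (d a) (firstForm g Φ d) q * Hi) a b :=
      congrFun₂ (matDeriv_inv (v := d a) F.map.isOpen hq F.contDiffOn_firstForm F.det_ne) a b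
    have h3 : (Hi * matDeriv (d a) (firstForm g Φ d) q).trace
        = 2 * ∑ i, ∑ j, Hi i j * A a i j := by
      simp only [Matrix.trace, Matrix.diag, Matrix.mul_apply, F.matDeriv_firstForm_tangent hq,
        mul_add, Finset.sum_add_distrib, two_mul]
      congr 1
      rw [Finset.sum_comm]
      exact Finset.sum_congr rfl fun i _ => Finset.sum_congr rfl fun j _ => by rw [hsymm]
    have h4 : (Hi * matDeriv (d a) (firstForm g Φ d) q * Hi) a b
        = ∑ i, ∑ j, Hi a i * (A a i j + A a j i) * Hi j b := by
      simp only [Matrix.mul_apply, F.matDeriv_firstForm_tangent hq, Finset.sum_mul]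
      rw [Finset.sum_comm]
    rw [h2, h3, h4]
    change 1 / 2 * s * (2 * _) * Hi a b + s * -_ = _
    ring
  simp only [h1]
  set y : Fin n → ℝ := fun a => ∑ b, Hi a b * w b with hy
  have e1 : ∑ a, ∑ b, s * ((∑ i, ∑ j, Hi i j * A a i j) * Hi a b
        - ∑ i, ∑ j, Hi a i * (A a i j + A a j i) * Hi j b) * w b
      = s * (∑ a, ∑ i, ∑ j, Hi i j * A a i j * y a
        - ∑ a, ∑ i, ∑ j, Hi a i * (A a i j + A a j i) * y j) := by
    simp only [hy, mul_sub, sub_mul, Finset.mul_sum, Finset.sum_mul, Finset.sum_sub_distrib]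
    congr 1
    · refine Finset.sum_congr rfl fun a _ => ?_
      rw [Finset.sum_comm]
      refine Finset.sum_congr rfl fun i _ => ?_
      rw [Finset.sum_comm]
      exact Finset.sum_congr rfl fun _ _ => Finset.sum_congr rfl fun _ _ => by ring
    · refine Finset.sum_congr rfl fun a _ => ?_
      rw [Finset.sum_comm]
      refine Finset.sum_congr rfl fun i _ => ?_
      rw [Finset.sum_comm]
      exact Finset.sum_congr rfl fun _ _ => Finset.sum_congr rfl fun _ _ => by ring
  have e2 : ∑ a, ∑ i, ∑ j, Hi a i * (A a i j + A a j i) * y j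
      = ∑ a, ∑ i, ∑ j, Hi a i * A a i j * y j + ∑ a, ∑ i, ∑ j, Hi i j * A a i j * y a := by
    simp only [mul_add, add_mul, Finset.sum_add_distrib]
    congr 1
    rw [Finset.sum_comm]
    conv_lhs => enter [2, i]; rw [Finset.sum_comm]
    rw [Finset.sum_comm]
    refine Finset.sum_congr rfl fun j _ => ?_
    rw [Finset.sum_comm]
    exact Finset.sum_congr rfl fun a _ => Finset.sum_congr rfl fun i _ => by rw [hAs a j]
  have e3 : ∑ a, ∑ b, Hi a b * ∑ c, ∑ e, Hi c e * A b a c * w e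
      = ∑ a, ∑ i, ∑ j, Hi a i * A a i j * y j := by
    refine Finset.sum_congr rfl fun a _ => Finset.sum_congr rfl fun b _ => ?_
    rw [Finset.mul_sum]
    refine Finset.sum_congr rfl fun c _ => ?_
    simp only [hy, Finset.mul_sum]
    exact Finset.sum_congr rfl fun e _ => by rw [hAs b a]; ring
  rw [e1, e2, e3]
  ring

/-- The variation of the mean curvature density in a direction `v` along which `Φ` moves normally
at the point `q`, with the first derivatives at `q` of that motion prescribed. -/
theorem dirDeriv_trace_mul_sqrt (hq : q ∈ S) (f₀ : ℝ) (df : Fin n → ℝ)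
    (hess DX : Matrix (Fin n) (Fin n) ℝ)
    (hT : tangentAlong Φ v q = f₀ • ν q)
    (hDT : ∀ a, covDeriv g Φ (d a) (tangentAlong Φ v) q
      = df a • ν q + f₀ • covDeriv g Φ (d a) ν q + ∑ c, DX a c • tangentAlong Φ (d c) q)
    (hP : ∀ a b, dirDeriv (d b)
        (fun p => metricPairing g (Φ p) (tangentAlong Φ (d a) p) (covDeriv g Φ v ν p)) q
      = -ϵ * hess a b + ∑ c, DX b c * secondForm g Φ d ν q c a) :
    dirDeriv v (fun p => ((firstForm g Φ d p)⁻¹ * secondForm g Φ d ν p).trace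
        * Real.sqrt |(firstForm g Φ d p).det|) q
      = Real.sqrt |(firstForm g Φ d q).det| *
        (f₀ * (((firstForm g Φ d q)⁻¹ * secondForm g Φ d ν q).trace ^ 2
            - ((firstForm g Φ d q)⁻¹ * secondForm g Φ d ν q
              * (firstForm g Φ d q)⁻¹ * secondForm g Φ d ν q).trace
            - ∑ α, ∑ β, ricci g (Φ q) α β * ν q α * ν q β)
          + ((firstForm g Φ d q)⁻¹ * secondForm g Φ d ν q).trace * DX.trace
          - ϵ * (∑ a, ∑ b, (firstForm g Φ d q)⁻¹ a b * hess a b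
            - ∑ a, ∑ b, (firstForm g Φ d q)⁻¹ a b
              * ∑ c, ∑ e, (firstForm g Φ d q)⁻¹ c e * lowerChristoffelInd g Φ d q b a c * df e)) := by
  have hdet := F.det_ne q hq
  have hHid := fun a b =>
    (F.contDiffOn_inv_firstForm a b).differentiableAt_of_isOpen F.map.isOpen hq
  have hKd := fun a b => (F.contDiffOn_secondForm a b).differentiableAt_of_isOpen F.map.isOpen hq
  set s := Real.sqrt |(firstForm g Φ d q).det| with hs
  have hHs := F.firstForm_symm hq
  have hHis := F.inv_firstForm_symm hq
  have hKs := F.secondForm_symm hq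
  have hHiH : (firstForm g Φ d q)⁻¹ * firstForm g Φ d q = 1 :=
    Matrix.nonsing_inv_mul _ hdet.isUnit
  have hHHi : firstForm g Φ d q * (firstForm g Φ d q)⁻¹ = 1 :=
    Matrix.mul_nonsing_inv _ hdet.isUnit
  have hdH : matDeriv v (firstForm g Φ d) q
      = (2 * f₀) • secondForm g Φ d ν q + DX * firstForm g Φ d q
        + firstForm g Φ d q * DXᵀ := by
    have hhalf : ∀ a b, metricPairing g (Φ q) (covDeriv g Φ (d a) (tangentAlong Φ v) q)
        (tangentAlong Φ (d b) q)
        = f₀ * secondForm g Φ d ν q b a + (DX * firstForm g Φ d q) a b := by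
      intro a b
      rw [hDT, metricPairing_add_left, metricPairing_add_left, metricPairing_smul_left,
        metricPairing_smul_left, F.orth q hq, metricPairing_sum_left,
        F.pairing_comm hq (covDeriv _ _ _ _ _)]
      simp only [metricPairing_smul_left, Matrix.mul_apply]
      rw [mul_zero, zero_add]
      rfl
    ext a b
    have ht : firstForm g Φ d q * DXᵀ = (DX * firstForm g Φ d q)ᵀ := by
      rw [Matrix.transpose_mul, hHs]
    have hk : secondForm g Φ d ν q b a = secondForm g Φ d ν q a b := congrFun₂ hKs a b
    rw [F.matDeriv_firstForm hq, hhalf, hhalf, hk, ht]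
    simp only [Matrix.add_apply, Matrix.smul_apply, smul_eq_mul, Matrix.transpose_apply]
    ring
  set Hi := (firstForm g Φ d q)⁻¹ with hHi
  set K := secondForm g Φ d ν q with hK
  have hKK : ∀ a b, metricPairing g (Φ q) (covDeriv g Φ (d a) ν q) (covDeriv g Φ (d b) ν q)
      = (K * Hi * K) a b := by
    intro a b
    rw [F.pairing_eq hq, F.pairing_normal_covDeriv_normal hq, mul_zero, zero_mul, add_zero]
    simp only [Matrix.mul_apply, Finset.sum_mul]
    rw [Finset.sum_comm]
    refine Finset.sum_congr rfl fun c _ => Finset.sum_congr rfl fun e _ => ?_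
    have h1 : K a e = K e a := congrFun₂ hKs e a
    rw [h1]
    change Hi e c * K e a * K c b = _
    ring
  have hPdf : ∀ a, metricPairing g (Φ q) (tangentAlong Φ (d a) q) (covDeriv g Φ v ν q)
      = -ϵ * df a := by
    intro a
    rw [F.pairing_tangent_covDeriv_normal hq, hDT, metricPairing_add_right,
      metricPairing_add_right, metricPairing_smul_right, metricPairing_smul_right, F.unit q hq,
      F.pairing_normal_covDeriv_normal hq, F.pairing_comm hq, metricPairing_sum_left]
    have : ∀ c, metricPairing g (Φ q) (DX a c • tangentAlong Φ (d c) q) (ν q) = 0 := fun c => by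
      rw [metricPairing_smul_left, F.pairing_comm hq, F.orth q hq, mul_zero]
    simp only [this, Finset.sum_const_zero]
    ring
  let Γ : Matrix (Fin n) (Fin n) ℝ := Matrix.of fun a b =>
    ∑ c, ∑ e, Hi c e * lowerChristoffelInd g Φ d q b a c * df e
  have hM : ∀ a b, metricPairing g (Φ q) (tangentAlong Φ (d a) q)
      (covDeriv g Φ (d b) (covDeriv g Φ v ν) q)
      = -ϵ * hess a b + (K * DXᵀ) a b + ϵ * Γ a b := by
    intro a b
    have h := dirDeriv_metricPairing (v := d b) F.metric F.map hq
      (F.differentiableAt_tangentAlong hq (d a)) (F.differentiableAt_covDeriv_normal hq v)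
    have h2 : metricPairing g (Φ q) (covDeriv g Φ (d b) (tangentAlong Φ (d a)) q)
        (covDeriv g Φ v ν q) = -ϵ * Γ a b := by
      rw [F.pairing_eq hq, F.pairing_normal_covDeriv_normal hq, mul_zero, add_zero]
      simp only [hPdf, Γ, Matrix.of_apply, Finset.mul_sum]
      refine Finset.sum_congr rfl fun c _ => Finset.sum_congr rfl fun e _ => ?_
      rw [F.pairing_comm hq (tangentAlong Φ (d c) q)]
      simp only [lowerChristoffelInd]
      ring
    have h3 : ∑ c, DX b c * K c a = (K * DXᵀ) a b := by
      rw [Matrix.mul_apply]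
      refine Finset.sum_congr rfl fun c _ => ?_
      have h1 : K a c = K c a := congrFun₂ hKs c a
      rw [h1, Matrix.transpose_apply, mul_comm]
    rw [hP, h2, h3] at h
    linarith
  let Rm : Matrix (Fin n) (Fin n) ℝ := Matrix.of fun a b =>
    metricPairing g (Φ q) (tangentAlong Φ (d a) q)
      (curvOp g (Φ q) (ν q) (tangentAlong Φ (d b) q) (ν q))
  have hcurv : ∀ c : ℝ, ∀ u r W : Fin (n + 1) → ℝ,
      curvOp g (Φ q) (c • u) r W = c • curvOp g (Φ q) u r W := by
    intro c u r W
    ext l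
    simp only [curvOp, Pi.smul_apply, smul_eq_mul, Finset.mul_sum]
    exact Finset.sum_congr rfl fun _ _ => Finset.sum_congr rfl fun _ _ =>
      Finset.sum_congr rfl fun _ _ => by ring
  have hdK : matDeriv v (secondForm g Φ d ν) q
      = f₀ • (K * Hi * K) + DX * K + K * DXᵀ - ϵ • hess + ϵ • Γ + f₀ • Rm := by
    ext a b
    rw [F.matDeriv_secondForm hq, hM, hDT, hT, hcurv, metricPairing_smul_right,
      metricPairing_add_left, metricPairing_add_left, metricPairing_smul_left,
      metricPairing_smul_left, F.pairing_normal_covDeriv_normal hq, metricPairing_sum_left, hKK]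
    simp only [metricPairing_smul_left, Matrix.add_apply, Matrix.sub_apply, Matrix.smul_apply,
      smul_eq_mul, mul_zero, zero_add]
    change f₀ * (K * Hi * K) a b + ∑ c, DX a c * K c b + _ + f₀ * Rm a b = _
    rw [Matrix.mul_apply (M := DX)]
    ring
  have hRic : (Hi * Rm).trace = -∑ α, ∑ β, ricci g (Φ q) α β * ν q α * ν q β := by
    rw [← ricci_eq_of_frame F.metric (F.map.mapsTo q hq) (F.orth q hq) (F.unit q hq) F.sign_sq hdet,
      Matrix.trace_mul_comm]
    simp only [Matrix.trace, Matrix.diag, Matrix.mul_apply]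
    refine Finset.sum_congr rfl fun a _ => Finset.sum_congr rfl fun b _ => ?_
    have h1 : Hi b a = Hi a b := congrFun₂ hHis a b
    rw [h1, mul_comm]
    rfl
  have hcontr : ∀ Q : Matrix (Fin n) (Fin n) ℝ, (Hi * Q).trace = ∑ a, ∑ b, Hi a b * Q a b := by
    intro Q
    rw [Matrix.trace_mul_comm]
    simp only [Matrix.trace, Matrix.diag, Matrix.mul_apply]
    refine Finset.sum_congr rfl fun a _ => Finset.sum_congr rfl fun b _ => ?_
    have h1 : Hi b a = Hi a b := congrFun₂ hHis a b
    rw [h1, mul_comm]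
  have hDXt : (Hi * (K * DXᵀ)).trace = (Hi * (DX * K)).trace := by
    rw [← Matrix.trace_transpose, Matrix.transpose_mul, Matrix.transpose_mul,
      Matrix.transpose_transpose, hHis, hKs, Matrix.trace_mul_comm]
  have hdk : dirDeriv v (fun p => ((firstForm g Φ d p)⁻¹ * secondForm g Φ d ν p).trace) q
      = -f₀ * (Hi * K * Hi * K).trace - ϵ * (Hi * hess).trace + ϵ * (Hi * Γ).trace
        + f₀ * (Hi * Rm).trace := by
    have hprod : ∀ a b, DifferentiableAt ℝ
        (fun p => ((firstForm g Φ d p)⁻¹ * secondForm g Φ d ν p) a b) q := by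
      intro a b
      simp only [Matrix.mul_apply]
      exact DifferentiableAt.fun_sum fun c _ => (hHid a c).mul (hKd c b)
    rw [dirDeriv_trace hprod, matDeriv_mul hHid hKd,
      matDeriv_inv F.map.isOpen hq F.contDiffOn_firstForm F.det_ne, hdH, hdK]
    change (-(Hi * _ * Hi) * K + Hi * _).trace = _
    have x1 : Hi * ((2 * f₀) • K + DX * firstForm g Φ d q + firstForm g Φ d q * DXᵀ) * Hi
        = (2 * f₀) • (Hi * K * Hi) + Hi * DX + DXᵀ * Hi := by
      rw [mul_add, mul_add, add_mul, add_mul, Matrix.mul_smul, Matrix.smul_mul,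
        Matrix.mul_assoc Hi (DX * _), Matrix.mul_assoc DX, hHHi, Matrix.mul_one,
        ← Matrix.mul_assoc Hi (firstForm g Φ d q), hHiH, Matrix.one_mul]
    have x2 : (DXᵀ * (Hi * K)).trace = (Hi * (DX * K)).trace := by
      rw [← hDXt, ← Matrix.mul_assoc Hi K, Matrix.trace_mul_comm _ DXᵀ]
    rw [x1]
    simp only [Matrix.neg_mul, add_mul, mul_add, mul_sub, Matrix.smul_mul, Matrix.mul_smul,
      Matrix.trace_add, Matrix.trace_sub, Matrix.trace_neg, Matrix.trace_smul, smul_eq_mul, hDXt,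
      x2, Matrix.mul_assoc]
    ring
  have hds : dirDeriv v (fun p => Real.sqrt |(firstForm g Φ d p).det|) q
      = s * (f₀ * (Hi * K).trace + DX.trace) := by
    rw [F.dirDeriv_sqrt_abs_det hq, hdH]
    change 1 / 2 * s * (Hi * _).trace = _
    rw [mul_add, mul_add, Matrix.trace_add, Matrix.trace_add, Matrix.mul_smul, Matrix.trace_smul,
      ← Matrix.mul_assoc Hi (firstForm g Φ d q), hHiH, Matrix.one_mul, Matrix.trace_transpose,
      Matrix.trace_mul_comm Hi (DX * _), Matrix.mul_assoc DX, hHHi, Matrix.mul_one, smul_eq_mul]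
    ring
  rw [dirDeriv_mul (F.contDiffOn_trace.differentiableAt_of_isOpen F.map.isOpen hq)
    (F.contDiffOn_sqrt_abs_det_firstForm.differentiableAt_of_isOpen F.map.isOpen hq), hdk, hds,
    hRic, hcontr hess, hcontr Γ]
  change _ * s + (Hi * K).trace * _ = _
  simp only [Γ, Matrix.of_apply]
  ring

end IsHypersurfaceFamily

end HypersurfaceFamily

section Slice

variable {n : ℕ}

/-- The `a`-th spatial coordinate direction of `ℝ × ℝⁿ`. -/
def spaceDir (a : Fin n) : ℝ × (Fin n → ℝ) := (0, Pi.single a 1)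

variable {F G : ℝ × (Fin n → ℝ) → ℝ} {U : Set (Fin n → ℝ)} {t : ℝ} {z : Fin n → ℝ} {a : Fin n}

lemma pder_slice (hF : DifferentiableAt ℝ F (t, z)) :
    pder (fun y => F (t, y)) a z = dirDeriv (spaceDir a) F (t, z) := by
  have h := hF.hasFDerivAt.comp z (hasFDerivAt_prodMk_right t z)
  have h' : fderiv ℝ (fun y => F (t, y)) z = _ := h.fderiv
  rw [pder, h']
  simp [dirDeriv, spaceDir]

lemma deriv_slice (hF : DifferentiableAt ℝ F (t, z)) :
    deriv (fun r => F (r, z)) t = dirDeriv (1, 0) F (t, z) := by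
  have h := hF.hasFDerivAt.comp_hasDerivAt t ((hasDerivAt_id t).prodMk (hasDerivAt_const t z))
  exact h.deriv

lemma dirDeriv_slice_congr (hU : IsOpen U) (hz : z ∈ U) (hF : DifferentiableAt ℝ F (t, z))
    (hG : DifferentiableAt ℝ G (t, z)) (h : ∀ y ∈ U, F (t, y) = G (t, y)) :
    dirDeriv (spaceDir a) F (t, z) = dirDeriv (spaceDir a) G (t, z) := by
  rw [← pder_slice hF, ← pder_slice hG]
  exact dirDeriv_congr hU hz h

lemma dirDeriv_spaceDir_snd {f : (Fin n → ℝ) → ℝ} (hf : DifferentiableAt ℝ f z) :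
    dirDeriv (spaceDir a) (fun p => f p.2) (t, z) = pder f a z :=
  (pder_slice (F := fun p => f p.2) (hf.comp (t, z) differentiableAt_snd)).symm

lemma pder_slice_flux {k s : ℝ × (Fin n → ℝ) → ℝ} {B : Fin n → ℝ × (Fin n → ℝ) → ℝ}
    {x : ℝ × (Fin n → ℝ) → ℝ} {w : Fin n → ℝ × (Fin n → ℝ) → ℝ} {ϵ : ℝ}
    (hk : DifferentiableAt ℝ k (t, z)) (hs : DifferentiableAt ℝ s (t, z))
    (hB : ∀ b, DifferentiableAt ℝ (B b) (t, z)) (hx : DifferentiableAt ℝ x (t, z))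
    (hw : ∀ b, DifferentiableAt ℝ (w b) (t, z)) :
    pder (fun y => s (t, y) * (k (t, y) * x (t, y) - ϵ * ∑ b, B b (t, y) * w b (t, y))) a z
      = dirDeriv (spaceDir a) (fun p => k p * s p) (t, z) * x (t, z)
        + k (t, z) * s (t, z) * dirDeriv (spaceDir a) x (t, z)
        - ϵ * ∑ b, (dirDeriv (spaceDir a) (fun p => s p * B b p) (t, z) * w b (t, z)
          + s (t, z) * (B b (t, z) * dirDeriv (spaceDir a) (w b) (t, z))) := by
  have hks : DifferentiableAt ℝ (fun p => k p * s p) (t, z) := hk.mul hs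
  have hksx : DifferentiableAt ℝ (fun p => k p * s p * x p) (t, z) := hks.mul hx
  have hsB : ∀ b, DifferentiableAt ℝ (fun p => s p * B b p) (t, z) := fun b => hs.mul (hB b)
  have hsBw : ∀ b, DifferentiableAt ℝ (fun p => s p * B b p * w b p) (t, z) :=
    fun b => (hsB b).mul (hw b)
  have hsum : DifferentiableAt ℝ (fun p => ∑ b, s p * B b p * w b p) (t, z) :=
    DifferentiableAt.fun_sum fun b _ => hsBw b
  have hϵ : DifferentiableAt ℝ (fun p => ϵ * ∑ b, s p * B b p * w b p) (t, z) := hsum.const_mul _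
  have e : (fun y => s (t, y) * (k (t, y) * x (t, y) - ϵ * ∑ b, B b (t, y) * w b (t, y)))
      = fun y => k (t, y) * s (t, y) * x (t, y) - ϵ * ∑ b, s (t, y) * B b (t, y) * w b (t, y) := by
    ext y
    simp only [mul_assoc, ← Finset.mul_sum]
    ring
  rw [e, pder_slice (F := fun p => k p * s p * x p - ϵ * ∑ b, s p * B b p * w b p) (hksx.sub hϵ),
    dirDeriv_sub hksx hϵ, dirDeriv_mul hks hx, dirDeriv_const_mul _ hsum,
    dirDeriv_sum fun b _ => hsBw b]
  congr 2
  exact Finset.sum_congr rfl fun b _ => by rw [dirDeriv_mul (hsB b) (hw b), mul_assoc (s (t, z))]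

lemma covDeriv_slice_congr {N : ℕ} {g : (Fin N → ℝ) → Fin N → Fin N → ℝ}
    {Φ A B : ℝ × (Fin n → ℝ) → Fin N → ℝ} (hU : IsOpen U) (hz : z ∈ U)
    (hA : ∀ μ, DifferentiableAt ℝ (fun p => A p μ) (t, z))
    (hB : ∀ μ, DifferentiableAt ℝ (fun p => B p μ) (t, z)) (h : ∀ y ∈ U, A (t, y) = B (t, y)) :
    covDeriv g Φ (spaceDir a) A (t, z) = covDeriv g Φ (spaceDir a) B (t, z) := by
  ext ν
  simp only [covDeriv, h z hz]
  rw [dirDeriv_slice_congr hU hz (hA ν) (hB ν) fun y hy => congrFun (h y hy) ν]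

lemma time_eq_add_sum (x : Fin n → ℝ) :
    ((1, 0) : ℝ × (Fin n → ℝ)) = (1, -x) + ∑ c, x c • spaceDir c := by
  have h : ∑ c, x c • spaceDir c = (0, x) := by
    ext i
    · simp [spaceDir, Prod.fst_sum]
    · simp [spaceDir, Prod.snd_sum, Finset.sum_apply, Pi.single_apply]
  rw [h]
  simp

end Slice

namespace IsHypersurfaceFamily

variable {n : ℕ} {g : (Fin (n + 1) → ℝ) → Fin (n + 1) → Fin (n + 1) → ℝ}
  {V : Set (Fin (n + 1) → ℝ)} {Φ : ℝ × (Fin n → ℝ) → Fin (n + 1) → ℝ}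
  {S : Set (ℝ × (Fin n → ℝ))} {ν : ℝ × (Fin n → ℝ) → Fin (n + 1) → ℝ} {ϵ : ℝ}
  {U : Set (Fin n → ℝ)} {f : (Fin n → ℝ) → ℝ} {X : (Fin n → ℝ) → Fin n → ℝ} {y z : Fin n → ℝ}

lemma tangentAlong_comoving (hdec : tangentAlong Φ (1, 0) (0, z)
    = f z • ν (0, z) + ∑ a, X z a • tangentAlong Φ (spaceDir a) (0, z)) (x : Fin n → ℝ) :
    tangentAlong Φ (1, -x) (0, z)
      = f z • ν (0, z) + ∑ c, (X z c - x c) • tangentAlong Φ (spaceDir c) (0, z) := by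
  ext l
  have hl := congrFun hdec l
  rw [tangentAlong, time_eq_add_sum x, dirDeriv_add_dir, dirDeriv_sum_dir] at hl
  simp only [dirDeriv_smul_dir] at hl
  simp only [Pi.add_apply, Finset.sum_apply, Pi.smul_apply, smul_eq_mul, sub_mul,
    Finset.sum_sub_distrib] at hl ⊢
  simp only [tangentAlong] at hl ⊢
  linarith

section Variation

variable (F : IsHypersurfaceFamily g V Φ S spaceDir ν ϵ) (hU : IsOpen U)
  (hS : ∀ z ∈ U, ((0 : ℝ), z) ∈ S) (hf : ContDiffOn ℝ ∞ f U)
  (hX : ∀ a, ContDiffOn ℝ ∞ (fun z => X z a) U)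
  (hdec : ∀ z ∈ U, tangentAlong Φ (1, 0) (0, z)
    = f z • ν (0, z) + ∑ a, X z a • tangentAlong Φ (spaceDir a) (0, z))
include F hU hS hf hX hdec

lemma covDeriv_tangentAlong_comoving (hz : z ∈ U) (x : Fin n → ℝ) (a : Fin n) :
    covDeriv g Φ (spaceDir a) (tangentAlong Φ (1, -x)) (0, z)
      = pder f a z • ν (0, z) + f z • covDeriv g Φ (spaceDir a) ν (0, z)
        + ∑ c, (pder (fun z => X z c) a z • tangentAlong Φ (spaceDir c) (0, z)
          + (X z c - x c) • covDeriv g Φ (spaceDir a) (tangentAlong Φ (spaceDir c)) (0, z)) := by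
  have hq := hS z hz
  have hfz := hf.differentiableAt_of_isOpen hU hz
  have hXz := fun c => (hX c).differentiableAt_of_isOpen hU hz
  have hf' : DifferentiableAt ℝ (fun p : ℝ × (Fin n → ℝ) => f p.2) (0, z) :=
    hfz.comp ((0 : ℝ), z) differentiableAt_snd
  have hX' : ∀ c, DifferentiableAt ℝ (fun p : ℝ × (Fin n → ℝ) => X p.2 c - x c) (0, z) := fun c =>
    (DifferentiableAt.comp ((0 : ℝ), z) (g := fun z => X z c) (hXz c)
      differentiableAt_snd).sub_const _
  have hν := F.differentiableAt_normal hq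
  have he := fun c => F.differentiableAt_tangentAlong hq (spaceDir c)
  have hfν : ∀ μ, DifferentiableAt ℝ (fun p => (f p.2 • ν p) μ) (0, z) := fun μ => hf'.mul (hν μ)
  have hXe : ∀ c μ, DifferentiableAt ℝ
      (fun p => ((X p.2 c - x c) • tangentAlong Φ (spaceDir c) p) μ) (0, z) :=
    fun c μ => (hX' c).mul (he c μ)
  have hsum : ∀ μ, DifferentiableAt ℝ
      (fun p => (∑ c, (X p.2 c - x c) • tangentAlong Φ (spaceDir c) p) μ) (0, z) := by
    intro μ
    simp only [Finset.sum_apply]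
    exact DifferentiableAt.fun_sum fun c _ => hXe c μ
  rw [covDeriv_slice_congr hU hz
    (B := fun p => f p.2 • ν p + ∑ c, (X p.2 c - x c) • tangentAlong Φ (spaceDir c) p)
    (F.differentiableAt_tangentAlong hq _) (fun μ => (hfν μ).add (hsum μ))
    (fun y hy => tangentAlong_comoving (hdec y hy) x),
    covDeriv_add hfν hsum, covDeriv_smul hf' hν, covDeriv_sum fun c _ => hXe c,
    dirDeriv_spaceDir_snd hfz]
  congr 1
  refine Finset.sum_congr rfl fun c _ => ?_
  rw [covDeriv_smul (hX' c) (he c), dirDeriv_spaceDir_snd (f := fun z => X z c - x c)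
    ((hXz c).sub_const _)]
  have : pder (fun z => X z c - x c) a z = pder (fun z => X z c) a z := by
    rw [pder, fderiv_sub_const]
    rfl
  rw [this]

lemma pairing_tangent_covDeriv_normal_comoving (hz : z ∈ U) (x : Fin n → ℝ) (a : Fin n) :
    metricPairing g (Φ (0, z)) (tangentAlong Φ (spaceDir a) (0, z))
        (covDeriv g Φ (1, -x) ν (0, z))
      = -ϵ * pder f a z + ∑ c, (X z c - x c) * secondForm g Φ spaceDir ν (0, z) c a := by
  have hq := hS z hz
  have hK : ∀ c, metricPairing g (Φ (0, z))
      (covDeriv g Φ (spaceDir a) (tangentAlong Φ (spaceDir c)) (0, z)) (ν (0, z))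
      = -secondForm g Φ spaceDir ν (0, z) c a := by
    intro c
    rw [secondForm, Matrix.of_apply, F.pairing_tangent_covDeriv_normal hq, neg_neg,
      covDeriv_tangentAlong_comm F.metric F.map hq, F.pairing_comm hq]
  rw [F.pairing_tangent_covDeriv_normal hq,
    covDeriv_tangentAlong_comoving F hU hS hf hX hdec hz, F.pairing_comm hq]
  simp only [metricPairing_add_left, metricPairing_smul_left, metricPairing_sum_left,
    F.unit _ hq, F.pairing_comm hq (tangentAlong _ _ _), F.orth _ hq,
    F.pairing_comm hq (covDeriv g Φ _ ν _), F.pairing_normal_covDeriv_normal hq, hK]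
  simp only [mul_zero, zero_add, add_zero, mul_neg, Finset.sum_neg_distrib]
  ring

theorem dirDeriv_time_trace_mul_sqrt (hy : y ∈ U) :
    dirDeriv (1, 0) (fun p => ((firstForm g Φ spaceDir p)⁻¹ * secondForm g Φ spaceDir ν p).trace
        * Real.sqrt |(firstForm g Φ spaceDir p).det|) (0, y)
      = f y * (((firstForm g Φ spaceDir (0, y))⁻¹ * secondForm g Φ spaceDir ν (0, y)).trace ^ 2
            - ((firstForm g Φ spaceDir (0, y))⁻¹ * secondForm g Φ spaceDir ν (0, y)
              * (firstForm g Φ spaceDir (0, y))⁻¹ * secondForm g Φ spaceDir ν (0, y)).trace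
            - ∑ α, ∑ β, ricci g (Φ (0, y)) α β * ν (0, y) α * ν (0, y) β)
          * Real.sqrt |(firstForm g Φ spaceDir (0, y)).det|
        + ∑ a, pder (fun z => Real.sqrt |(firstForm g Φ spaceDir (0, z)).det|
            * (((firstForm g Φ spaceDir (0, z))⁻¹ * secondForm g Φ spaceDir ν (0, z)).trace * X z a
              - ϵ * ∑ b, (firstForm g Φ spaceDir (0, z))⁻¹ a b * pder f b z)) a y := by
  have hq := hS y hy
  have hSo := F.map.isOpen
  have hfa : ∀ a, ContDiffOn ℝ ∞ (pder f a) U := fun a => hf.dirDeriv hU _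
  have hfa' := fun a => (hfa a).differentiableAt_of_isOpen hU hy
  have hXy := fun c => (hX c).differentiableAt_of_isOpen hU hy
  have hfl : ∀ a, DifferentiableAt ℝ (fun p : ℝ × (Fin n → ℝ) => pder f a p.2) (0, y) :=
    fun a => DifferentiableAt.comp ((0 : ℝ), y) (g := pder f a) (hfa' a) differentiableAt_snd
  have hXl : ∀ c, DifferentiableAt ℝ (fun p : ℝ × (Fin n → ℝ) => X p.2 c) (0, y) := fun c =>
    DifferentiableAt.comp ((0 : ℝ), y) (g := fun z => X z c) (hXy c) differentiableAt_snd
  have hKd := fun a b => (F.contDiffOn_secondForm a b).differentiableAt_of_isOpen hSo hq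
  have hkd := F.contDiffOn_trace.differentiableAt_of_isOpen hSo hq
  have hsd := F.contDiffOn_sqrt_abs_det_firstForm.differentiableAt_of_isOpen hSo hq
  have hHd := fun a b => (F.contDiffOn_inv_firstForm a b).differentiableAt_of_isOpen hSo hq
  let hess : Matrix (Fin n) (Fin n) ℝ := Matrix.of fun a b => pder (pder f a) b y
  let DX : Matrix (Fin n) (Fin n) ℝ := Matrix.of fun a c => pder (fun z => X z c) a y
  have hmain := F.dirDeriv_trace_mul_sqrt (v := (1, -X y)) hq (f y) (fun a => pder f a y) hess DX
    (by simpa using tangentAlong_comoving (hdec y hy) (X y))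
    (fun a => by simpa [DX] using covDeriv_tangentAlong_comoving F hU hS hf hX hdec hy (X y) a)
    (fun a b => by
      have hP : DifferentiableAt ℝ (fun p => metricPairing g (Φ p) (tangentAlong Φ (spaceDir a) p)
          (covDeriv g Φ (1, -X y) ν p)) (0, y) :=
        (ContDiffOn.metricPairing F.metric F.map (F.contDiffOn_tangentAlong _)
          (ContDiffOn.covDeriv F.metric F.map F.smooth_normal _)).differentiableAt_of_isOpen hSo hq
      have hXK : ∀ c, DifferentiableAt ℝ
          (fun p => (X p.2 c - X y c) * secondForm g Φ spaceDir ν p c a) (0, y) :=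
        fun c => ((hXl c).sub_const _).mul (hKd c a)
      rw [dirDeriv_slice_congr hU hy
        (G := fun p => -ϵ * pder f a p.2
          + ∑ c, (X p.2 c - X y c) * secondForm g Φ spaceDir ν p c a)
        hP (((hfl a).const_mul _).add (DifferentiableAt.fun_sum fun c _ => hXK c))
        (fun z hz => pairing_tangent_covDeriv_normal_comoving F hU hS hf hX hdec hz (X y) a),
        dirDeriv_add ((hfl a).const_mul _) (DifferentiableAt.fun_sum fun c _ => hXK c),
        dirDeriv_const_mul _ (hfl a), dirDeriv_sum fun c _ => hXK c,
        dirDeriv_spaceDir_snd (hfa' a)]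
      congr 1
      refine Finset.sum_congr rfl fun c _ => ?_
      rw [dirDeriv_mul ((hXl c).sub_const _) (hKd c a), dirDeriv_sub (hXl c) (by fun_prop),
        dirDeriv_const, dirDeriv_spaceDir_snd (hXy c)]
      simp [DX])
  have hdiv := F.divergence_inv_density hq fun e => pder f e y
  have hhess : ∀ a b, pder (pder f b) a y = hess a b := fun a b => dirDeriv_comm hf hU hy
  rw [Finset.sum_congr rfl fun a _ => pder_slice_flux hkd hsd (hHd a) (hXl a) hfl]
  have hXy' : ∀ a, pder (fun z => X z a) a y = DX a a := fun a => rfl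
  simp only [dirDeriv_spaceDir_snd (hfa' _), dirDeriv_spaceDir_snd (hXy _), hhess, hXy']
  rw [time_eq_add_sum (X y), dirDeriv_add_dir, dirDeriv_sum_dir]
  simp only [dirDeriv_smul_dir]
  rw [hmain]
  simp only [Finset.sum_add_distrib, Finset.sum_sub_distrib, mul_add, ← Finset.mul_sum, hdiv,
    mul_comm (X y _)]
  have hDX : ∑ a, DX a a = DX.trace := rfl
  rw [hDX]
  ring

end Variation

end IsHypersurfaceFamily

/-- pointwise core of Theorem 5.3 of the paper, in local coordinates:
the first variation of the mean-curvature density is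
`∂_t (k_t √|det h_t|)|_{t=0} = f (k² − Tr_h(K²) − Ric(n,n)) √|det h|
  + Σ_a ∂_a (√|det h| (k X^a − ϵ h^{ab} ∂_b f))`. -/
theorem first_variation_GHY_density
    (n : ℕ) (hn : 1 ≤ n)
    (U : Set (Fin n → ℝ)) (hU : IsOpen U)
    (V : Set (Fin (n + 1) → ℝ)) (hV : IsOpen V)
    (g : (Fin (n + 1) → ℝ) → Fin (n + 1) → Fin (n + 1) → ℝ)
    (hg : ∀ μ ν, ContDiffOn ℝ (⊤ : ℕ∞) (fun x => g x μ ν) V)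
    (hgsym : ∀ x ∈ V, ∀ μ ν, g x μ ν = g x ν μ)
    (hgunit : ∀ x ∈ V, IsUnit (Matrix.of (g x)).det)
    (δ : ℝ) (hδ : 0 < δ)
    (φ : ℝ → (Fin n → ℝ) → Fin (n + 1) → ℝ)
    (hφ : ∀ μ, ContDiffOn ℝ (⊤ : ℕ∞) (fun q : ℝ × (Fin n → ℝ) => φ q.1 q.2 μ)
      (Set.Ioo (-δ) δ ×ˢ U))
    (hφV : ∀ t ∈ Set.Ioo (-δ) δ, ∀ y ∈ U, φ t y ∈ V)
    (himm : ∀ t ∈ Set.Ioo (-δ) δ, ∀ y ∈ U, ∀ v : Fin n → ℝ,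
      (∀ μ, (∑ a, v a * Dphi φ t y a μ) = 0) → v = 0)
    (nrm : ℝ → (Fin n → ℝ) → Fin (n + 1) → ℝ)
    (hnrm : ∀ μ, ContDiffOn ℝ (⊤ : ℕ∞) (fun q : ℝ × (Fin n → ℝ) => nrm q.1 q.2 μ)
      (Set.Ioo (-δ) δ ×ˢ U))
    (ϵ : ℝ) (hϵ : ϵ = 1 ∨ ϵ = -1)
    (horth : ∀ t ∈ Set.Ioo (-δ) δ, ∀ y ∈ U, ∀ a : Fin n,
      (∑ μ, ∑ ν, g (φ t y) μ ν * nrm t y μ * Dphi φ t y a ν) = 0)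
    (hunit : ∀ t ∈ Set.Ioo (-δ) δ, ∀ y ∈ U,
      (∑ μ, ∑ ν, g (φ t y) μ ν * nrm t y μ * nrm t y ν) = ϵ)
    (f : (Fin n → ℝ) → ℝ) (hf : ContDiffOn ℝ (⊤ : ℕ∞) f U)
    (X : (Fin n → ℝ) → Fin n → ℝ) (hX : ∀ a, ContDiffOn ℝ (⊤ : ℕ∞) (fun y => X y a) U)
    (hdec : ∀ y ∈ U, ∀ μ, deriv (fun t => φ t y μ) 0
      = f y * nrm 0 y μ + ∑ a, X y a * Dphi φ 0 y a μ)
    (hh0 : ∀ y ∈ U, IsUnit (Matrix.of (fun a b => indMet g φ 0 y a b)).det) :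
    ∀ y ∈ U,
      deriv (fun t => trExtK g φ nrm t y
          * Real.sqrt |(Matrix.of (fun a b => indMet g φ t y a b)).det|) 0
        = f y * ((trExtK g φ nrm 0 y) ^ 2
              - (∑ a, ∑ b, ∑ c, ∑ d, indMetInv g φ 0 y a b * extK g φ nrm 0 y b c
                  * indMetInv g φ 0 y c d * extK g φ nrm 0 y d a)
              - ∑ α, ∑ β, ricci g (φ 0 y) α β * nrm 0 y α * nrm 0 y β)
            * Real.sqrt |(Matrix.of (fun a b => indMet g φ 0 y a b)).det|
          + ∑ a, pder (fun z =>
              Real.sqrt |(Matrix.of (fun a' b' => indMet g φ 0 z a' b')).det|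
                * (trExtK g φ nrm 0 z * X z a
                  - ϵ * ∑ b, indMetInv g φ 0 z a b * pder f b z)) a y := by
  have hϵ2 : ϵ * ϵ = 1 := by rcases hϵ with rfl | rfl <;> norm_num
  let Φ : ℝ × (Fin n → ℝ) → Fin (n + 1) → ℝ := fun p => φ p.1 p.2
  let ν : ℝ × (Fin n → ℝ) → Fin (n + 1) → ℝ := fun p => nrm p.1 p.2
  have hS₀ : IsOpen (Set.Ioo (-δ) δ ×ˢ U) := isOpen_Ioo.prod hU
  have hmetric : IsMetricOn g V := ⟨hV, hg, hgsym, hgunit⟩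
  have hmap₀ : IsSmoothMap Φ (Set.Ioo (-δ) δ ×ˢ U) V :=
    ⟨hS₀, hφ, fun p hp => hφV p.1 hp.1 p.2 hp.2⟩
  have hD : ∀ t ∈ Set.Ioo (-δ) δ, ∀ z ∈ U, ∀ a,
      Dphi φ t z a = tangentAlong Φ (spaceDir a) (t, z) := by
    intro t ht z hz a
    ext μ
    exact pder_slice (F := fun p => Φ p μ) ((hφ μ).differentiableAt_of_isOpen hS₀ ⟨ht, hz⟩)
  have hH : ∀ t ∈ Set.Ioo (-δ) δ, ∀ z ∈ U,
      Matrix.of (fun a b => indMet g φ t z a b) = firstForm g Φ spaceDir (t, z) := by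
    intro t ht z hz
    ext a b
    simp only [Matrix.of_apply, indMet, hD t ht z hz]
    rfl
  have hK : ∀ t ∈ Set.Ioo (-δ) δ, ∀ z ∈ U, ∀ a b,
      extK g φ nrm t z a b = secondForm g Φ spaceDir ν (t, z) a b := by
    intro t ht z hz a b
    have h : ∀ μ, pder (fun z => nrm t z μ) b z
        = dirDeriv (spaceDir b) (fun p => ν p μ) (t, z) := fun μ =>
      pder_slice (F := fun p => ν p μ) ((hnrm μ).differentiableAt_of_isOpen hS₀ ⟨ht, hz⟩)
    simp only [extK, hD t ht z hz, h]
    rfl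
  have hdetc : ContinuousOn (fun p => (firstForm g Φ spaceDir p).det) (Set.Ioo (-δ) δ ×ˢ U) :=
    (ContDiffOn.matrix_det fun a b => ContDiffOn.metricPairing hmetric hmap₀
      (fun μ => (hφ μ).dirDeriv hS₀ (spaceDir a))
      (fun μ => (hφ μ).dirDeriv hS₀ (spaceDir b))).continuousOn
  let S := (Set.Ioo (-δ) δ ×ˢ U) ∩ (fun p => (firstForm g Φ spaceDir p).det) ⁻¹' {0}ᶜ
  have hSo : IsOpen S := hdetc.isOpen_inter_preimage hS₀ isOpen_compl_singleton
  have F : IsHypersurfaceFamily g V Φ S spaceDir ν ϵ :=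
    { metric := hmetric
      map := ⟨hSo, fun μ => (hφ μ).mono Set.inter_subset_left, fun p hp => hmap₀.mapsTo p hp.1⟩
      smooth_normal := fun μ => (hnrm μ).mono Set.inter_subset_left
      orth := fun p hp a => by
        have h := horth p.1 hp.1.1 p.2 hp.1.2 a
        rw [hD p.1 hp.1.1 p.2 hp.1.2] at h
        exact h
      unit := fun p hp => hunit p.1 hp.1.1 p.2 hp.1.2
      sign_sq := hϵ2
      det_ne := fun p hp => hp.2 }
  have h0 : (0 : ℝ) ∈ Set.Ioo (-δ) δ := ⟨by linarith, hδ⟩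
  have hS : ∀ z ∈ U, ((0 : ℝ), z) ∈ S := fun z hz =>
    ⟨⟨h0, hz⟩, by
      have h := (hh0 z hz).ne_zero
      rwa [hH 0 h0 z hz] at h⟩
  have hdec' : ∀ z ∈ U, tangentAlong Φ (1, 0) (0, z)
      = f z • ν (0, z) + ∑ a, X z a • tangentAlong Φ (spaceDir a) (0, z) := by
    intro z hz
    ext μ
    have h := hdec z hz μ
    simp only [hD 0 h0 z hz] at h
    rw [deriv_slice (F := fun p => Φ p μ)
      ((hφ μ).differentiableAt_of_isOpen hS₀ ⟨h0, hz⟩)] at h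
    simp only [Pi.add_apply, Pi.smul_apply, Finset.sum_apply, smul_eq_mul]
    exact h
  have hk : ∀ p ∈ S, trExtK g φ nrm p.1 p.2
      = ((firstForm g Φ spaceDir p)⁻¹ * secondForm g Φ spaceDir ν p).trace := by
    intro p hp
    simp only [trExtK, indMetInv, hH p.1 hp.1.1 p.2 hp.1.2, hK p.1 hp.1.1 p.2 hp.1.2, Matrix.trace,
      Matrix.diag, Matrix.mul_apply]
    refine Finset.sum_congr rfl fun a _ => Finset.sum_congr rfl fun b _ => ?_
    exact congrArg _ (congrFun₂ (F.secondForm_symm hp) b a)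
  intro y hy
  have hq := hS y hy
  have hmain := IsHypersurfaceFamily.dirDeriv_time_trace_mul_sqrt F hU hS hf hX hdec' hy
  have hL : deriv (fun t => trExtK g φ nrm t y
      * Real.sqrt |(Matrix.of (fun a b => indMet g φ t y a b)).det|) 0
      = dirDeriv (1, 0) (fun p => ((firstForm g Φ spaceDir p)⁻¹ * secondForm g Φ spaceDir ν p).trace
        * Real.sqrt |(firstForm g Φ spaceDir p).det|) (0, y) := by
    rw [← deriv_slice ((F.contDiffOn_trace.mul
      F.contDiffOn_sqrt_abs_det_firstForm).differentiableAt_of_isOpen hSo hq)]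
    refine Filter.EventuallyEq.deriv_eq ?_
    have hc : ContinuousAt (fun t : ℝ => (t, y)) 0 := by fun_prop
    filter_upwards [hc.preimage_mem_nhds (hSo.mem_nhds hq)] with t ht
    rw [hk (t, y) ht, hH t ht.1.1 y ht.1.2]
  have hR : ∀ a, pder (fun z =>
      Real.sqrt |(Matrix.of (fun a' b' => indMet g φ 0 z a' b')).det|
        * (trExtK g φ nrm 0 z * X z a - ϵ * ∑ b, indMetInv g φ 0 z a b * pder f b z)) a y
      = pder (fun z => Real.sqrt |(firstForm g Φ spaceDir (0, z)).det|
        * (((firstForm g Φ spaceDir (0, z))⁻¹ * secondForm g Φ spaceDir ν (0, z)).trace * X z a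
          - ϵ * ∑ b, (firstForm g Φ spaceDir (0, z))⁻¹ a b * pder f b z)) a y := by
    refine fun a => dirDeriv_congr hU hy fun z hz => ?_
    simp only [indMetInv, hH 0 h0 z hz, hk (0, z) (hS z hz)]
  have hQ : ∑ a, ∑ b, ∑ c, ∑ d, indMetInv g φ 0 y a b * extK g φ nrm 0 y b c
      * indMetInv g φ 0 y c d * extK g φ nrm 0 y d a
      = ((firstForm g Φ spaceDir (0, y))⁻¹ * secondForm g Φ spaceDir ν (0, y)
        * (firstForm g Φ spaceDir (0, y))⁻¹ * secondForm g Φ spaceDir ν (0, y)).trace := by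
    simp only [indMetInv, hH 0 h0 y hy, hK 0 h0 y hy, Matrix.trace, Matrix.diag, Matrix.mul_apply,
      Finset.sum_mul]
    refine Finset.sum_congr rfl fun a _ => ?_
    rw [Finset.sum_comm]
    conv_lhs => enter [2, c]; rw [Finset.sum_comm]
    rw [Finset.sum_comm]
  rw [hL, hmain, hQ, hk (0, y) hq, hH 0 h0 y hy, Finset.sum_congr rfl fun a _ => hR a]
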